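/- arXiv:2311.15234 — 2 statements merged into one kernel-verified Lean document; each statement's English description precedes it below -/
import Mathlib

section
/- There exist a computable map T on the Cantor space X over the alphabet {0,1,S} and a closed T-invariant set A ⊆ X such that: (i) the inner collection {w : [w] ∩ A ≠ ∅} is Π₂ and Tot many-one reduces to it; (ii) T coincides with the shift on A; (iii) A is a topological attractor of T, and for every shift-ergodic fully supported Borel probability measure λ on X, A is a metric attractor of T with respect to λ. -/
open Filter Topology MeasureTheory Set
open scoped ENNReal NNReal

/-- Cylinder of a finite word in Cantor space: the set of sequences beginning with `w`. -/
def cyl {𝒜 : Type*} (w : List 𝒜) : Set (ℕ → 𝒜) :=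
  {x | ∀ i : Fin w.length, x i = w.get i}

/-- The shift map on Cantor space. -/
def shiftMap {𝒜 : Type*} (x : ℕ → 𝒜) : ℕ → 𝒜 := fun i => x (i + 1)

/-- ω-limit set of `x` under iteration of `T`: the set of accumulation points of the orbit. -/
def omegaSet {X : Type*} [TopologicalSpace X] (T : X → X) (x : X) : Set X :=
  {y | MapClusterPt y Filter.atTop fun n => T^[n] x}

/-- Realm of attraction `ρ(A) = {x : ω(x) ⊆ A}`. -/
def realm {X : Type*} [TopologicalSpace X] (T : X → X) (A : Set X) : Set X :=
  {x | omegaSet T x ⊆ A}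

/-- `A` is a topological attractor of `T`: a closed invariant set whose realm of attraction is
residual, and such that no strictly smaller closed subset has nonmeager realm of attraction. -/
def IsTopAttractor {X : Type*} [TopologicalSpace X] (T : X → X) (A : Set X) : Prop :=
  IsClosed A ∧ Set.MapsTo T A A ∧ realm T A ∈ residual X ∧
    ∀ A' : Set X, IsClosed A' → A' ⊂ A → IsMeagre (realm T A')

/-- `A` is a metric attractor of `T` w.r.t. `lam`: a closed invariant set whose realm of
attraction has full measure, and no strictly smaller closed subset has realm of positive
measure. -/
def IsMetricAttractor {X : Type*} [TopologicalSpace X] [MeasurableSpace X]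
    (T : X → X) (lam : Measure X) (A : Set X) : Prop :=
  IsClosed A ∧ Set.MapsTo T A A ∧ lam (realm T A) = 1 ∧
    ∀ A' : Set X, IsClosed A' → A' ⊂ A → lam (realm T A') = 0

/-- Empirical (Birkhoff) measures `ν_n(x) = (1/n) ∑_{i<n} δ_{T^i x}`. -/
noncomputable def empMeasure {X : Type*} [MeasurableSpace X] (T : X → X) (x : X) (n : ℕ) :
    Measure X :=
  (n : ℝ≥0∞)⁻¹ • ∑ i ∈ Finset.range n, Measure.dirac (T^[i] x)

/-- Weak-* convergence of a sequence of measures: integrals of continuous functions converge. -/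
def WeakTendsto {X : Type*} [TopologicalSpace X] [MeasurableSpace X]
    (μs : ℕ → Measure X) (μ : Measure X) : Prop :=
  ∀ φ : C(X, ℝ), Filter.Tendsto (fun n => ∫ x, φ x ∂(μs n)) Filter.atTop (nhds (∫ x, φ x ∂μ))

/-- Topological support of a measure: points all of whose open neighbourhoods have positive
measure. -/
def measSupport {X : Type*} [TopologicalSpace X] [MeasurableSpace X]
    (μ : Measure X) : Set X :=
  {x | ∀ U : Set X, IsOpen U → x ∈ U → 0 < μ U}

/-- `A` is a statistical (physical) attractor of `T` w.r.t. `lam`: there is a `T`-invariant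
probability measure `μ` with support `A` such that for `lam`-a.e. `x` the empirical measures
converge weak-* to `μ`. -/
def IsStatAttractor {X : Type*} [TopologicalSpace X] [MeasurableSpace X]
    (T : X → X) (lam : Measure X) (A : Set X) : Prop :=
  IsClosed A ∧ ∃ μ : Measure X, IsProbabilityMeasure μ ∧
    Measure.map T μ = μ ∧ measSupport μ = A ∧
    ∀ᵐ x ∂lam, WeakTendsto (empMeasure T x) μ

/-- `A` is strongly attracting: there is an open `U ⊇ A` with `T (closure U) ⊆ U` and
`A = ⋂ₙ Tⁿ(U)`. -/
def StronglyAttracting {X : Type*} [TopologicalSpace X] (T : X → X) (A : Set X) : Prop :=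
  ∃ U : Set X, IsOpen U ∧ A ⊆ U ∧ T '' (closure U) ⊆ U ∧ A = ⋂ n : ℕ, T^[n] '' U

/-- `S` is Σ₁ (recursively enumerable). -/
def SigmaOne {I : Type*} [Primcodable I] (S : Set I) : Prop :=
  ∃ f : I × ℕ → Bool, Computable f ∧ ∀ i, i ∈ S ↔ ∃ a, f (i, a) = true

/-- `S` is Π₁ (co-r.e.). -/
def PiOne {I : Type*} [Primcodable I] (S : Set I) : Prop := SigmaOne Sᶜ

/-- `S` is Σ₂. -/
def SigmaTwo {I : Type*} [Primcodable I] (S : Set I) : Prop :=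
  ∃ f : I × ℕ × ℕ → Bool, Computable f ∧ ∀ i, i ∈ S ↔ ∃ a, ∀ b, f (i, a, b) = true

/-- `S` is Π₂. -/
def PiTwo {I : Type*} [Primcodable I] (S : Set I) : Prop :=
  ∃ f : I × ℕ × ℕ → Bool, Computable f ∧ ∀ i, i ∈ S ↔ ∀ a, ∃ b, f (i, a, b) = true

/-- A map of Cantor space is computable if `(T x) n` is computed by a computable function from
`n` and the finite prefix `[x 0, …, x (α n)]` of `x`, for a computable modulus `α`. -/
def CantorComputable {𝒜 : Type} [Primcodable 𝒜] (T : (ℕ → 𝒜) → (ℕ → 𝒜)) : Prop :=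
  ∃ (α : ℕ → ℕ) (β : ℕ → List 𝒜 → 𝒜), Computable α ∧ Computable₂ β ∧
    ∀ (x : ℕ → 𝒜) (n : ℕ), T x n = β n (List.ofFn fun i : Fin (α n + 1) => x i)

/-- A Borel probability measure on Cantor space is computable if the measures of finite unions
of cylinders are uniformly lower-computable: `lam(⋃_{w ∈ W} [w]) = sup_k q (W, k)` for a
computable `q`. -/
def ComputableCantorMeasure {𝒜 : Type} [Primcodable 𝒜] [MeasurableSpace 𝒜]
    (lam : Measure (ℕ → 𝒜)) : Prop :=
  ∃ q : List (List 𝒜) × ℕ → ℚ, Computable q ∧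
    ∀ W : List (List 𝒜), (lam (⋃ w ∈ W, cyl w)).toReal = ⨆ k, (q (W, k) : ℝ)

/-- Indices of machines halting on input 0. -/
def HaltSet : Set ℕ := {e | ((Denumerable.ofNat Nat.Partrec.Code e).eval 0).Dom}

/-- Indices of total machines. -/
def TotSet : Set ℕ := {e | ∀ n, ((Denumerable.ofNat Nat.Partrec.Code e).eval n).Dom}

/-- Indices of machines with finite domain. -/
def FinSet : Set ℕ := {e | {n | ((Denumerable.ofNat Nat.Partrec.Code e).eval n).Dom}.Finite}

/-! ### Primitive recursion with bounded quantifiers -/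

section BoundedQuantifiers

variable {α : Type*} [Primcodable α]

theorem PrimrecPred.bounded_exists {f : α → ℕ} {p : α → ℕ → Prop} (hf : Primrec f)
    (hp : PrimrecPred fun q : α × ℕ => p q.1 q.2) : PrimrecPred fun a => ∃ i < f a, p a i := by
  have hR : PrimrecRel fun (i : ℕ) (a : α) => p a i :=
    PrimrecPred.comp hp (Primrec.pair Primrec.snd Primrec.fst)
  exact (hR.exists_mem_list.comp (Primrec.list_range.comp hf) Primrec.id).of_eq (by simp)

theorem PrimrecPred.bounded_forall {f : α → ℕ} {p : α → ℕ → Prop} (hf : Primrec f)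
    (hp : PrimrecPred fun q : α × ℕ => p q.1 q.2) : PrimrecPred fun a => ∀ i < f a, p a i := by
  have hR : PrimrecRel fun (i : ℕ) (a : α) => p a i :=
    PrimrecPred.comp hp (Primrec.pair Primrec.snd Primrec.fst)
  exact (hR.forall_mem_list.comp (Primrec.list_range.comp hf) Primrec.id).of_eq (by simp)

end BoundedQuantifiers

/-! ### Stages of total machines -/

/-- The machine of index `e` halts within `k` steps on every input below `m`. -/
def HaltsBelow (e m k : ℕ) : Prop :=
  ∀ j < m, (Nat.Partrec.Code.evaln k (Denumerable.ofNat Nat.Partrec.Code e) j).isSome = true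

/-- `s` codes a pair `(m, k)` with `e ≤ m` and `k` the least time bound by which the machine of
index `e` has halted on every input below `m`. -/
def Stage (e s : ℕ) : Prop :=
  e ≤ s.unpair.1 ∧ HaltsBelow e s.unpair.1 s.unpair.2 ∧
    ∀ k < s.unpair.2, ¬ HaltsBelow e s.unpair.1 k

theorem Stage.le {e s : ℕ} (h : Stage e s) : e ≤ s :=
  h.1.trans (Nat.unpair_left_le s)

theorem dom_iff_exists_evaln (e n : ℕ) :
    ((Denumerable.ofNat Nat.Partrec.Code e).eval n).Dom ↔
      ∃ k, (Nat.Partrec.Code.evaln k (Denumerable.ofNat Nat.Partrec.Code e) n).isSome = true := by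
  simp only [Part.dom_iff_mem, Option.isSome_iff_exists, Nat.Partrec.Code.evaln_complete]
  exact exists_comm

theorem exists_haltsBelow {e : ℕ} (he : e ∈ TotSet) (m : ℕ) : ∃ k, HaltsBelow e m k := by
  induction m with
  | zero => exact ⟨0, fun j hj => absurd hj (Nat.not_lt_zero j)⟩
  | succ m ih =>
    obtain ⟨k, hk⟩ := ih
    obtain ⟨l, hl⟩ := (dom_iff_exists_evaln e m).1 (he m)
    have mono : ∀ {a b j : ℕ}, a ≤ b →
        (Nat.Partrec.Code.evaln a (Denumerable.ofNat Nat.Partrec.Code e) j).isSome = true →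
        (Nat.Partrec.Code.evaln b (Denumerable.ofNat Nat.Partrec.Code e) j).isSome = true := by
      intro a b j hab h
      obtain ⟨v, hv⟩ := Option.isSome_iff_exists.1 h
      exact Option.isSome_iff_exists.2 ⟨v, Nat.Partrec.Code.evaln_mono hab hv⟩
    refine ⟨max k l, fun j hj => ?_⟩
    rcases Nat.lt_succ_iff_lt_or_eq.1 hj with hj | rfl
    · exact mono (le_max_left _ _) (hk j hj)
    · exact mono (le_max_right _ _) hl

theorem exists_stage_ge {e : ℕ} (he : e ∈ TotSet) (N : ℕ) : ∃ s, N ≤ s ∧ Stage e s := by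
  classical
  have h := exists_haltsBelow he (max e N)
  refine ⟨Nat.pair (max e N) (Nat.find h), (le_max_right _ _).trans (Nat.left_le_pair _ _), ?_⟩
  simp only [Stage, Nat.unpair_pair]
  exact ⟨le_max_left _ _, Nat.find_spec h, fun k hk => Nat.find_min h hk⟩

theorem finite_setOf_stage {e : ℕ} (he : e ∉ TotSet) : {s | Stage e s}.Finite := by
  obtain ⟨n, hn⟩ : ∃ n, ¬ ((Denumerable.ofNat Nat.Partrec.Code e).eval n).Dom := by
    simpa [TotSet] using he
  refine Set.Finite.of_finite_image (f := fun s => s.unpair.1)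
    ((Set.finite_Iic n).subset ?_) ?_
  · rintro _ ⟨s, hs, rfl⟩
    by_contra hlt
    exact hn ((dom_iff_exists_evaln e n).2 ⟨_, hs.2.1 n (not_le.1 hlt)⟩)
  · intro s hs t ht hst
    have hst : s.unpair.1 = t.unpair.1 := hst
    have h2 : s.unpair.2 = t.unpair.2 := by
      rcases lt_trichotomy s.unpair.2 t.unpair.2 with h | h | h
      · exact absurd (hst ▸ hs.2.1) (ht.2.2 _ h)
      · exact h
      · exact absurd (hst.symm ▸ ht.2.1) (hs.2.2 _ h)
    rw [← Nat.pair_unpair s, ← Nat.pair_unpair t, hst, h2]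

theorem exists_mem_totSet_ge (N : ℕ) : ∃ e ∈ TotSet, N ≤ e := by
  have hinj : Function.Injective
      fun n => Encodable.encode (Nat.Partrec.Code.const n) := fun a b h =>
    Nat.Partrec.Code.const_inj (Encodable.encode_injective h)
  obtain ⟨_, ⟨n, rfl⟩, hn⟩ := (Set.infinite_range_of_injective hinj).exists_gt N
  refine ⟨_, fun m => ?_, hn.le⟩
  simp [Nat.Partrec.Code.eval_const]

theorem primrecPred_isSome_evaln {α : Type*} [Primcodable α] {k e j : α → ℕ}
    (hk : Primrec k) (he : Primrec e) (hj : Primrec j) :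
    PrimrecPred fun a => (Nat.Partrec.Code.evaln (k a)
      (Denumerable.ofNat Nat.Partrec.Code (e a)) (j a)).isSome = true :=
  Primrec.eq.comp (Primrec.option_isSome.comp (Nat.Partrec.Code.primrec_evaln.comp
    ((hk.pair ((Primrec.ofNat _).comp he)).pair hj))) (Primrec.const true)

theorem primrecPred_haltsBelow {α : Type*} [Primcodable α] {e m k : α → ℕ}
    (he : Primrec e) (hm : Primrec m) (hk : Primrec k) :
    PrimrecPred fun a => HaltsBelow (e a) (m a) (k a) :=
  PrimrecPred.bounded_forall hm (primrecPred_isSome_evaln (hk.comp Primrec.fst)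
    (he.comp Primrec.fst) Primrec.snd)

theorem primrecPred_stage {α : Type*} [Primcodable α] {e s : α → ℕ}
    (he : Primrec e) (hs : Primrec s) : PrimrecPred fun a => Stage (e a) (s a) := by
  have h1 : Primrec fun a => (s a).unpair.1 := Primrec.fst.comp (Primrec.unpair.comp hs)
  have h2 : Primrec fun a => (s a).unpair.2 := Primrec.snd.comp (Primrec.unpair.comp hs)
  exact (Primrec.nat_le.comp he h1).and ((primrecPred_haltsBelow he h1 h2).and
    (PrimrecPred.bounded_forall h2 (primrecPred_haltsBelow (he.comp Primrec.fst)
      (h1.comp Primrec.fst) Primrec.snd).not))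

/-! ### Blocks and the cleaning map -/

/-- The `i`-th symbol of the block `S 0^s 1^(e+1) 0^s S`; the separator `S` is the letter `2`. -/
def blockSymbol (e s i : ℕ) : Fin 3 :=
  if i = 0 ∨ i = 2 * s + e + 2 then 2 else if s < i ∧ i ≤ s + e + 1 then 1 else 0

/-- The block `S 0^s 1^(e+1) 0^s S` occurs in `x` at position `p`. -/
def IsBlock (x : ℕ → Fin 3) (p e s : ℕ) : Prop :=
  ∀ i < 2 * s + e + 3, x (p + i) = blockSymbol e s i

/-- The position `p` is that of the first occurrence in `x` of the block `S 0^s 1^(e+1) 0^s S`. -/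
def IsFirstBlock (x : ℕ → Fin 3) (p e s : ℕ) : Prop :=
  IsBlock x p e s ∧ ∀ q < p, ¬ IsBlock x q e s

/-- The position `n` precedes every separator of `x`, or lies in the run of ones of the first
occurrence of a block `S 0^s 1^(e+1) 0^s S` such that `s` is a stage of `e`. -/
def Kept (x : ℕ → Fin 3) (n : ℕ) : Prop :=
  (∀ i < n, x i ≠ 2) ∨ ∃ p < n, ∃ s < n, ∃ e < n,
    Stage e s ∧ p + s < n ∧ n ≤ p + s + e + 1 ∧ IsFirstBlock x p e s

open Classical in
/-- Erase every letter `1` which is not kept. -/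
noncomputable def clean (x : ℕ → Fin 3) (n : ℕ) : Fin 3 :=
  if x n = 1 ∧ ¬ Kept x n then 0 else x n

/-- The map of the Π₂-complete attractor: clean, then shift. -/
noncomputable def cleanShift (x : ℕ → Fin 3) : ℕ → Fin 3 :=
  shiftMap (clean x)

/-! ### Computability of the map -/

theorem isBlock_congr {x y : ℕ → Fin 3} {p e s : ℕ}
    (h : ∀ i < p + (2 * s + e + 3), x i = y i) : IsBlock x p e s ↔ IsBlock y p e s := by
  refine forall₂_congr fun i hi => ?_
  rw [h (p + i) (by omega)]

theorem kept_congr {x y : ℕ → Fin 3} {n : ℕ} (h : ∀ i ≤ 4 * n, x i = y i) :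
    Kept x n ↔ Kept y n := by
  refine or_congr (forall₂_congr fun i hi => by rw [h i (by omega)]) ?_
  refine exists_congr fun p => and_congr_right fun hp => exists_congr fun s =>
    and_congr_right fun hs => exists_congr fun e => and_congr_right fun he =>
    and_congr_right fun _ => and_congr_right fun _ => and_congr_right fun _ =>
    and_congr (isBlock_congr fun i hi => h i (by omega)) (forall₂_congr fun q hq =>
      not_congr (isBlock_congr fun i hi => h i (by omega)))

theorem clean_congr {x y : ℕ → Fin 3} {n : ℕ} (h : ∀ i ≤ 4 * n, x i = y i) :
    clean x n = clean y n := by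
  have hc : (x n = 1 ∧ ¬ Kept x n) ↔ (y n = 1 ∧ ¬ Kept y n) := by
    rw [h n (by omega), kept_congr h]
  classical
  unfold clean
  exact if_congr hc rfl (h n (by omega))

section Primrec

variable {α : Type*} [Primcodable α] {l : α → List (Fin 3)} {n p e s : α → ℕ}

theorem primrec_letter (hl : Primrec l) (hn : Primrec n) :
    Primrec fun a => (l a).getD (n a) 0 :=
  (Primrec.list_getD (0 : Fin 3)).comp hl hn

theorem primrec_blockSymbol (he : Primrec e) (hs : Primrec s) (hn : Primrec n) :
    Primrec fun a => blockSymbol (e a) (s a) (n a) := by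
  have add : ∀ {f g : α → ℕ}, Primrec f → Primrec g → Primrec fun a => f a + g a :=
    fun hf hg => Primrec.nat_add.comp hf hg
  have hse : Primrec fun a => s a + e a + 1 := add (add hs he) (Primrec.const 1)
  have hlen : Primrec fun a => 2 * s a + e a + 2 :=
    add (add (Primrec.nat_mul.comp (Primrec.const 2) hs) he) (Primrec.const 2)
  exact Primrec.ite ((Primrec.eq.comp hn (Primrec.const 0)).or (Primrec.eq.comp hn hlen))
    (Primrec.const 2) (Primrec.ite ((Primrec.nat_lt.comp hs hn).and (Primrec.nat_le.comp hn hse))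
      (Primrec.const 1) (Primrec.const 0))

theorem primrecPred_isBlock (hl : Primrec l) (hp : Primrec p) (he : Primrec e) (hs : Primrec s) :
    PrimrecPred fun a => IsBlock (fun i => (l a).getD i 0) (p a) (e a) (s a) := by
  have hlen : Primrec fun a => 2 * s a + e a + 3 :=
    Primrec.nat_add.comp (Primrec.nat_add.comp (Primrec.nat_mul.comp (Primrec.const 2) hs) he)
      (Primrec.const 3)
  exact PrimrecPred.bounded_forall hlen (Primrec.eq.comp
    (primrec_letter (hl.comp Primrec.fst)
      (Primrec.nat_add.comp (hp.comp Primrec.fst) Primrec.snd))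
    (primrec_blockSymbol (he.comp Primrec.fst) (hs.comp Primrec.fst) Primrec.snd))

theorem primrecPred_isFirstBlock (hl : Primrec l) (hp : Primrec p) (he : Primrec e)
    (hs : Primrec s) :
    PrimrecPred fun a => IsFirstBlock (fun i => (l a).getD i 0) (p a) (e a) (s a) :=
  (primrecPred_isBlock hl hp he hs).and (PrimrecPred.bounded_forall hp
    (primrecPred_isBlock (hl.comp Primrec.fst) Primrec.snd (he.comp Primrec.fst)
      (hs.comp Primrec.fst)).not)

theorem primrecPred_kept (hl : Primrec l) (hn : Primrec n) :
    PrimrecPred fun a => Kept (fun i => (l a).getD i 0) (n a) := by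
  refine PrimrecPred.or (PrimrecPred.bounded_forall hn (Primrec.eq.comp
    (primrec_letter (hl.comp Primrec.fst) Primrec.snd) (Primrec.const 2)).not) ?_
  refine PrimrecPred.bounded_exists hn (PrimrecPred.bounded_exists (hn.comp Primrec.fst)
    (PrimrecPred.bounded_exists (hn.comp (Primrec.fst.comp Primrec.fst)) ?_))
  have ha : Primrec fun q : ((α × ℕ) × ℕ) × ℕ => q.1.1.1 :=
    Primrec.fst.comp (Primrec.fst.comp Primrec.fst)
  have hp : Primrec fun q : ((α × ℕ) × ℕ) × ℕ => q.1.1.2 :=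
    Primrec.snd.comp (Primrec.fst.comp Primrec.fst)
  have hs : Primrec fun q : ((α × ℕ) × ℕ) × ℕ => q.1.2 := Primrec.snd.comp Primrec.fst
  have he : Primrec fun q : ((α × ℕ) × ℕ) × ℕ => q.2 := Primrec.snd
  have hps := Primrec.nat_add.comp hp hs
  exact (primrecPred_stage he hs).and ((Primrec.nat_lt.comp hps (hn.comp ha)).and
    ((Primrec.nat_le.comp (hn.comp ha) (Primrec.succ.comp (Primrec.nat_add.comp hps he))).and
      (primrecPred_isFirstBlock (hl.comp ha) hp he hs)))

theorem primrec_clean (hl : Primrec l) (hn : Primrec n) :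
    Primrec fun a => clean (fun i => (l a).getD i 0) (n a) := by
  classical
  have hx := primrec_letter hl hn
  refine (Primrec.ite ((Primrec.eq.comp hx (Primrec.const 1)).and (primrecPred_kept hl hn).not)
    (Primrec.const 0) hx).of_eq fun a => ?_
  unfold clean
  congr

end Primrec

theorem cantorComputable_cleanShift : CantorComputable cleanShift := by
  refine ⟨fun n => 4 * n + 4, fun n l => clean (fun i => l.getD i 0) (n + 1), ?_, ?_, ?_⟩
  · exact (Primrec.nat_add.comp (Primrec.nat_mul.comp (Primrec.const 4) Primrec.id)
      (Primrec.const 4)).to_comp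
  · exact (primrec_clean Primrec.snd (Primrec.succ.comp Primrec.fst)).to_comp
  · intro x n
    refine clean_congr fun i hi => ?_
    have hlt : i < 4 * n + 4 + 1 := by omega
    simp [List.getD, hlt, -List.ofFn_succ]

/-! ### Dynamics of the cleaning map -/

theorem shiftMap_iterate {𝒜 : Type*} (x : ℕ → 𝒜) (n i : ℕ) : shiftMap^[n] x i = x (n + i) := by
  induction n generalizing i with
  | zero => simp
  | succ n ih =>
    rw [Function.iterate_succ_apply', shiftMap, ih]
    congr 1
    omega

theorem clean_eq_two {x : ℕ → Fin 3} {n : ℕ} : clean x n = 2 ↔ x n = 2 := by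
  unfold clean
  split_ifs with h
  · simp [h.1]
  · rfl

theorem clean_eq_one {x : ℕ → Fin 3} {n : ℕ} : clean x n = 1 ↔ x n = 1 ∧ Kept x n := by
  unfold clean
  split_ifs with h
  · simp [h.2]
  · exact ⟨fun h1 => ⟨h1, by simpa [h1] using h⟩, And.left⟩

theorem clean_of_ne_one {x : ℕ → Fin 3} {n : ℕ} (h : x n ≠ 1) : clean x n = x n :=
  if_neg fun h1 => h h1.1

theorem clean_of_kept {x : ℕ → Fin 3} {n : ℕ} (h : Kept x n) : clean x n = x n :=
  if_neg fun h1 => h1.2 h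

theorem clean_of_forall_ne_two {x : ℕ → Fin 3} (h : ∀ i, x i ≠ 2) : clean x = x :=
  funext fun _ => clean_of_kept (Or.inl fun i _ => h i)

theorem clean_of_forall_ne_one {x : ℕ → Fin 3} (h : ∀ i, x i ≠ 1) : clean x = x :=
  funext fun i => clean_of_ne_one (h i)

section BlockSymbol

variable {e s i : ℕ}

theorem blockSymbol_eq_two : blockSymbol e s i = 2 ↔ i = 0 ∨ i = 2 * s + e + 2 := by
  unfold blockSymbol
  split_ifs <;> simp_all

theorem blockSymbol_eq_one : blockSymbol e s i = 1 ↔ s < i ∧ i ≤ s + e + 1 := by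
  unfold blockSymbol
  split_ifs with h h'
  · simp only [show (2 : Fin 3) ≠ 1 by decide, false_iff]
    omega
  · simpa using h'
  · simpa using h'

end BlockSymbol

section Block

variable {x : ℕ → Fin 3} {p e s n : ℕ}

theorem IsBlock.eq_two_iff (h : IsBlock x p e s) (h1 : p ≤ n) (h2 : n ≤ p + 2 * s + e + 2) :
    x n = 2 ↔ n = p ∨ n = p + 2 * s + e + 2 := by
  obtain ⟨i, rfl⟩ := Nat.exists_eq_add_of_le h1
  rw [h i (by omega), blockSymbol_eq_two]
  omega

theorem IsBlock.eq_one_iff (h : IsBlock x p e s) (h1 : p ≤ n) (h2 : n ≤ p + 2 * s + e + 2) :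
    x n = 1 ↔ p + s < n ∧ n ≤ p + s + e + 1 := by
  obtain ⟨i, rfl⟩ := Nat.exists_eq_add_of_le h1
  rw [h i (by omega), blockSymbol_eq_one]
  omega

/-- Blocks occurring at the same position coincide. -/
theorem IsBlock.unique {e' s' : ℕ} (h : IsBlock x p e s) (h' : IsBlock x p e' s') :
    e = e' ∧ s = s' := by
  have hlen : 2 * s + e = 2 * s' + e' := by
    by_contra hne
    rcases Nat.lt_or_gt_of_ne hne with hlt | hlt
    · have := (h'.eq_two_iff (n := p + 2 * s + e + 2) (by omega) (by omega)).1
        ((h.eq_two_iff (by omega) le_rfl).2 (Or.inr rfl))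
      omega
    · have := (h.eq_two_iff (n := p + 2 * s' + e' + 2) (by omega) (by omega)).1
        ((h'.eq_two_iff (by omega) le_rfl).2 (Or.inr rfl))
      omega
  have h1 := (h'.eq_one_iff (n := p + s + 1) (by omega) (by omega)).1
    ((h.eq_one_iff (by omega) (by omega)).2 ⟨by omega, by omega⟩)
  have h2 := (h.eq_one_iff (n := p + s' + 1) (by omega) (by omega)).1
    ((h'.eq_one_iff (by omega) (by omega)).2 ⟨by omega, by omega⟩)
  omega

theorem IsFirstBlock.pos_unique {q : ℕ} (h : IsFirstBlock x p e s) (h' : IsFirstBlock x q e s) :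
    p = q :=
  le_antisymm (not_lt.1 fun hlt => h.2 q hlt h'.1) (not_lt.1 fun hlt => h'.2 p hlt h.1)

/-- The first occurrence of a block at a stage survives cleaning. -/
theorem IsFirstBlock.isBlock_clean (h : IsFirstBlock x p e s) (hst : Stage e s) :
    IsBlock (clean x) p e s := by
  intro i hi
  by_cases h1 : x (p + i) = 1
  · have hi1 := (h.1.eq_one_iff (by omega) (by omega)).1 h1
    have := hst.le
    rw [clean_of_kept, h.1 i hi]
    exact Or.inr ⟨p, by omega, s, by omega, e, by omega, hst, by omega, by omega, h⟩
  · rw [clean_of_ne_one h1, h.1 i hi]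

/-- Behind the first separator, every surviving one lies in the first occurrence of a block. -/
theorem exists_isFirstBlock {q : ℕ} (hn : clean x n = 1) (hq : x q = 2) (hqn : q ≤ n) :
    ∃ p e s, Stage e s ∧ p + s < n ∧ n ≤ p + s + e + 1 ∧ q ≤ p ∧ IsFirstBlock x p e s := by
  obtain ⟨h1, hk⟩ := clean_eq_one.1 hn
  have hlt : q < n := lt_of_le_of_ne hqn (by rintro rfl; simp [hq] at h1)
  rcases hk with hk | ⟨p, -, s, -, e, -, hst, hps, hpe, hb⟩
  · exact absurd hq (hk q hlt)
  · refine ⟨p, e, s, hst, hps, hpe, not_lt.1 fun hpq => ?_, hb⟩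
    have := (hb.1.eq_two_iff hpq.le (by omega)).1 hq
    omega

/-- A block of the cleaned sequence behind the first separator was a first occurrence. -/
theorem isFirstBlock_of_isBlock_clean (h : IsBlock (clean x) p e s) : IsFirstBlock x p e s := by
  have hp : x p = 2 := clean_eq_two.1 ((h.eq_two_iff le_rfl (by omega)).2 (Or.inl rfl))
  have h1 : clean x (p + s + 1) = 1 :=
    (h.eq_one_iff (by omega) (by omega)).2 ⟨by omega, by omega⟩
  obtain ⟨q, e', s', hst, hqs, hqe, hpq, hb⟩ := exists_isFirstBlock h1 hp (by omega)
  have hq2 : clean x q = 2 := clean_eq_two.2 ((hb.1.eq_two_iff le_rfl (by omega)).2 (Or.inl rfl))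
  have hqp : q = p := by
    have := (h.eq_two_iff hpq (by omega)).1 hq2
    omega
  subst hqp
  obtain ⟨rfl, rfl⟩ := h.unique (hb.isBlock_clean hst)
  exact hb

end Block

theorem clean_shift_clean (x : ℕ → Fin 3) (n : ℕ) :
    clean (shiftMap^[n] (clean x)) = shiftMap^[n] (clean x) := by
  funext m
  by_cases h1 : shiftMap^[n] (clean x) m = 1
  swap
  · exact clean_of_ne_one h1
  refine clean_of_kept ?_
  by_cases hS : ∀ i < m, shiftMap^[n] (clean x) i ≠ 2
  · exact Or.inl hS
  push Not at hS
  obtain ⟨i, him, hi⟩ := hS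
  rw [shiftMap_iterate] at h1 hi
  obtain ⟨p, e, s, hst, hps, hpe, hp, hb⟩ :=
    exists_isFirstBlock h1 (clean_eq_two.1 hi) (by omega)
  obtain ⟨q, rfl⟩ := Nat.exists_eq_add_of_le (show n ≤ p by omega)
  have shifted : ∀ r, IsBlock (shiftMap^[n] (clean x)) r e s ↔ IsBlock (clean x) (n + r) e s := by
    intro r
    refine forall₂_congr fun j _ => ?_
    rw [shiftMap_iterate, add_assoc]
  have := hst.le
  refine Or.inr ⟨q, by omega, s, by omega, e, by omega, hst, by omega, by omega,
    (shifted q).2 (hb.isBlock_clean hst), fun r hr hbr => ?_⟩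
  have := (isFirstBlock_of_isBlock_clean ((shifted r).1 hbr)).pos_unique hb
  omega

theorem cleanShift_iterate_succ (x : ℕ → Fin 3) (n : ℕ) :
    cleanShift^[n + 1] x = shiftMap^[n + 1] (clean x) := by
  induction n with
  | zero => rfl
  | succ n ih =>
    rw [Function.iterate_succ_apply', ih, cleanShift, clean_shift_clean,
      Function.iterate_succ_apply' shiftMap (n + 1)]

theorem cleanShift_iterate_apply (x : ℕ → Fin 3) {n : ℕ} (hn : 0 < n) (i : ℕ) :
    cleanShift^[n] x i = clean x (n + i) := by
  obtain ⟨n, rfl⟩ := Nat.exists_eq_succ_of_ne_zero hn.ne'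
  rw [cleanShift_iterate_succ, shiftMap_iterate]

/-! ### The attractor -/

/-- The subshift whose points either contain no letter `1`, or contain no separator and have a
single run of ones, which, when bounded on both sides, has length `e + 1` for the index `e` of a
total machine. -/
def totAttractor : Set (ℕ → Fin 3) :=
  {y | (∀ i j, y i = 1 → y j ≠ 2) ∧ (∀ i j k, i < j → j < k → y i = 1 → y k = 1 → y j = 1) ∧
    ∀ a e, y a ≠ 1 → (∀ i < e + 1, y (a + 1 + i) = 1) → y (a + e + 2) ≠ 1 → e ∈ TotSet}

theorem isClosed_totAttractor : IsClosed totAttractor := by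
  have heq : ∀ i (c : Fin 3), IsClopen {y : ℕ → Fin 3 | y i = c} := fun i c =>
    (isClopen_discrete {c}).preimage (continuous_apply i)
  have hne : ∀ i (c : Fin 3), IsClopen {y : ℕ → Fin 3 | y i ≠ c} := fun i c => (heq i c).compl
  have hrun : ∀ a e, IsOpen {y : ℕ → Fin 3 | ∀ i < e + 1, y (a + 1 + i) = 1} := fun a e => by
    simp only [ofPred_forall]
    exact (Set.finite_lt_nat (e + 1)).isOpen_biInter fun i _ => (heq _ 1).isOpen
  refine IsClosed.and ?_ (IsClosed.and ?_ ?_) <;> simp only [ofPred_forall (ι := ℕ)]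
  · exact isClosed_iInter fun i => isClosed_iInter fun j =>
      isClosed_imp (heq i 1).isOpen (hne j 2).isClosed
  · exact isClosed_iInter fun i => isClosed_iInter fun j => isClosed_iInter fun k =>
      isClosed_imp isOpen_const <| isClosed_imp isOpen_const <|
        isClosed_imp (heq i 1).isOpen <| isClosed_imp (heq k 1).isOpen (heq j 1).isClosed
  · exact isClosed_iInter fun a => isClosed_iInter fun e =>
      isClosed_imp (hne a 1).isOpen <| isClosed_imp (hrun a e) <|
        isClosed_imp (hne _ 1).isOpen isClosed_const

theorem mapsTo_shiftMap_totAttractor : MapsTo shiftMap totAttractor totAttractor := by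
  rintro y ⟨h1, h2, h3⟩
  refine ⟨fun i j => h1 _ _, fun i j k hij hjk => h2 _ _ _ (by omega) (by omega), ?_⟩
  intro a e ha he hae
  refine h3 (a + 1) e ha (fun i hi => ?_) ?_
  · rw [show a + 1 + 1 + i = a + 1 + i + 1 by omega]
    exact he i hi
  · rw [show a + 1 + e + 2 = a + e + 2 + 1 by omega]
    exact hae

theorem clean_of_mem_totAttractor {y : ℕ → Fin 3} (hy : y ∈ totAttractor) : clean y = y := by
  by_cases h : ∃ i, y i = 1
  · obtain ⟨i, hi⟩ := h
    exact clean_of_forall_ne_two fun j => hy.1 i j hi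
  · push Not at h
    exact clean_of_forall_ne_one h

theorem cleanShift_of_mem_totAttractor {y : ℕ → Fin 3} (hy : y ∈ totAttractor) :
    cleanShift y = shiftMap y := by
  rw [cleanShift, clean_of_mem_totAttractor hy]

/-! ### Limit sets of typical points -/

/-- Every finite word occurs infinitely often in `x`. -/
def IsTypical {𝒜 : Type*} (x : ℕ → 𝒜) : Prop :=
  ∀ w : List 𝒜, ∃ᶠ n in atTop, shiftMap^[n] x ∈ cyl w

theorem IsTypical.exists_ge {𝒜 : Type*} {x : ℕ → 𝒜} (hx : IsTypical x) (y : ℕ → 𝒜) (m N : ℕ) :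
    ∃ n, N ≤ n ∧ ∀ i < m, x (n + i) = y i := by
  obtain ⟨n, hn, hmem⟩ := frequently_atTop.1 (hx (List.ofFn fun i : Fin m => y i)) N
  refine ⟨n, hn, fun i hi => ?_⟩
  have := hmem ⟨i, by simpa using hi⟩
  simpa [shiftMap_iterate] using this

theorem hasBasis_nhds_prefix {𝒜 : Type*} [TopologicalSpace 𝒜] [DiscreteTopology 𝒜]
    (y : ℕ → 𝒜) : (𝓝 y).HasBasis (fun _ : ℕ => True) fun m => {z | ∀ i < m, z i = y i} := by
  refine ⟨fun t => ⟨fun ht => ?_, ?_⟩⟩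
  · obtain ⟨u, ⟨z, m, rfl⟩, hy, hu⟩ :=
      (PiNat.isTopologicalBasis_cylinders fun _ : ℕ => 𝒜).mem_nhds_iff.1 ht
    exact ⟨m, trivial, fun v hv => hu fun i hi => (hv i hi).trans (hy i hi)⟩
  · rintro ⟨m, -, hm⟩
    exact mem_of_superset ((PiNat.isOpen_cylinder (fun _ => 𝒜) y m).mem_nhds fun _ _ => rfl) hm

theorem mem_omegaSet_iff {𝒜 : Type*} [TopologicalSpace 𝒜] [DiscreteTopology 𝒜]
    {T : (ℕ → 𝒜) → ℕ → 𝒜} {x y : ℕ → 𝒜} :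
    y ∈ omegaSet T x ↔ ∀ m N : ℕ, ∃ n, N ≤ n ∧ ∀ i < m, T^[n] x i = y i := by
  simp only [omegaSet, mem_ofPred_eq, (hasBasis_nhds_prefix y).mapClusterPt_iff_frequently,
    frequently_atTop, true_implies]

/-- The position of the first occurrence of a given block is bounded. -/
theorem exists_bound_isFirstBlock (x : ℕ → Fin 3) {F : Set (ℕ × ℕ)} (hF : F.Finite) :
    ∃ b, ∀ p e s, (e, s) ∈ F → IsFirstBlock x p e s → p + s + e + 1 < b := by
  have hfin : {n | ∃ p e s, (e, s) ∈ F ∧ IsFirstBlock x p e s ∧ n = p + s + e + 1}.Finite := by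
    refine (hF.biUnion (t := fun c => {n | ∃ p, IsFirstBlock x p c.1 c.2 ∧
      n = p + c.2 + c.1 + 1}) fun c _ => Set.Subsingleton.finite ?_).subset ?_
    · rintro _ ⟨p, hp, rfl⟩ _ ⟨q, hq, rfl⟩
      rw [hp.pos_unique hq]
    · rintro _ ⟨p, e, s, hc, hb, rfl⟩
      exact Set.mem_biUnion hc ⟨p, hb, rfl⟩
  obtain ⟨b, hb⟩ := hfin.bddAbove
  exact ⟨b + 1, fun p e s hc h => Nat.lt_succ_of_le (hb ⟨p, e, s, hc, h, rfl⟩)⟩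

theorem finite_setOf_stage_le (N : ℕ) : {c : ℕ × ℕ | Stage c.1 c.2 ∧ c.2 ≤ N}.Finite :=
  ((Set.finite_Iic N).prod (Set.finite_Iic N)).subset fun _ hc =>
    ⟨hc.1.le.trans hc.2, hc.2⟩

/-- Far from the origin, ones and separators of a cleaned sequence are far apart. -/
theorem exists_separation {x : ℕ → Fin 3} {q : ℕ} (hq : x q = 2) (N : ℕ) :
    ∃ b, ∀ i j, b ≤ i → b ≤ j → clean x i = 1 → clean x j = 2 → i + N < j ∨ j + N < i := by
  obtain ⟨b, hb⟩ := exists_bound_isFirstBlock x (finite_setOf_stage_le N)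
  refine ⟨max b q, fun i j hi hj h1 h2 => ?_⟩
  obtain ⟨p, e, s, hst, hps, hpe, -, hf⟩ := exists_isFirstBlock h1 hq ((le_max_right _ _).trans hi)
  have hi : b ≤ i := (le_max_left _ _).trans hi
  have hsN : N < s := by
    by_contra hsN
    have := hb p e s ⟨hst, not_lt.1 hsN⟩ hf
    omega
  by_contra hcon
  have := (hf.1.eq_two_iff (n := j) (by omega) (by omega)).1 (clean_eq_two.1 h2)
  omega

/-- Every accumulation point of the orbit of a point containing a separator lies in the
attractor. -/
theorem omegaSet_cleanShift_subset {x : ℕ → Fin 3} {q : ℕ} (hq : x q = 2) :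
    omegaSet cleanShift x ⊆ totAttractor := by
  intro y hy
  rw [mem_omegaSet_iff] at hy
  have window : ∀ m N : ℕ, ∃ n, N ≤ n ∧ ∀ i < m, clean x (n + i) = y i := by
    intro m N
    obtain ⟨n, hn, h⟩ := hy m (N + 1)
    refine ⟨n, by omega, fun i hi => ?_⟩
    rw [← cleanShift_iterate_apply x (by omega), h i hi]
  have hsep : ∀ i j, y i = 1 → y j ≠ 2 := by
    intro i j hi hj
    obtain ⟨b, hb⟩ := exists_separation hq (i + j)
    obtain ⟨n, hn, h⟩ := window (i + j + 1) b
    have := hb (n + i) (n + j) (by omega) (by omega) ((h i (by omega)).trans hi)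
      ((h j (by omega)).trans hj)
    omega
  refine ⟨hsep, ?_, ?_⟩
  · intro i j k hij hjk hi hk
    obtain ⟨n, hn, h⟩ := window (k + 1) q
    rw [← h i (by omega)] at hi
    rw [← h k (by omega)] at hk
    obtain ⟨p, e, s, hst, hps, hpe, hqp, hb⟩ := exists_isFirstBlock hi hq (by omega)
    have hbc := hb.isBlock_clean hst
    rw [← h j (by omega)]
    by_cases hend : n + k ≤ p + 2 * s + e + 2
    · have := (hbc.eq_one_iff (by omega) hend).1 hk
      exact (hbc.eq_one_iff (by omega) (by omega)).2 ⟨by omega, by omega⟩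
    · have hS := (hbc.eq_two_iff (n := p + 2 * s + e + 2) (by omega) le_rfl).2 (Or.inr rfl)
      rw [show p + 2 * s + e + 2 = n + (p + 2 * s + e + 2 - n) by omega, h _ (by omega)] at hS
      exact absurd hS (hsep i _ (by rw [← h i (by omega)]; exact hi))
  · intro a e ha he hae
    by_contra hnot
    have hfin : {c : ℕ × ℕ | c.1 = e ∧ Stage c.1 c.2}.Finite :=
      ((Set.finite_singleton e).prod (finite_setOf_stage hnot)).subset fun c hc => by
        obtain ⟨c1, c2⟩ := c
        obtain ⟨rfl, hc⟩ := hc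
        exact ⟨rfl, hc⟩
    obtain ⟨b, hb⟩ := exists_bound_isFirstBlock x hfin
    obtain ⟨n, hn, h⟩ := window (a + e + 3) (max b q)
    have hbn : b ≤ n := (le_max_left _ _).trans hn
    have hqn : q ≤ n := (le_max_right _ _).trans hn
    rw [← h _ (by omega)] at ha hae
    have he' : ∀ i < e + 1, clean x (n + (a + 1 + i)) = 1 := fun i hi => by
      rw [h _ (by omega), he i hi]
    obtain ⟨p, e', s, hst, hps, hpe, hqp, hf⟩ :=
      exists_isFirstBlock (he' 0 (by omega)) hq (by omega)
    have hbc := hf.isBlock_clean hst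
    have hstart : n + a = p + s := by
      by_contra hne
      exact ha ((hbc.eq_one_iff (by omega) (by omega)).2 ⟨by omega, by omega⟩)
    have hlen : e = e' := by
      rcases lt_trichotomy e e' with hlt | heq | hlt
      · exact absurd ((hbc.eq_one_iff (by omega) (by omega)).2 ⟨by omega, by omega⟩) hae
      · exact heq
      · have := (hbc.eq_one_iff (n := n + (a + 1 + (e' + 1))) (by omega) ?_).1 (he' _ (by omega))
        · omega
        · omega
    have := hb p e' s ⟨hlen.symm, hst⟩ hf
    omega

/-- Arbitrarily far from the origin, the cleaning of a typical sequence contains a run of ones of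
length `e + 1` surrounded by long runs of zeros, whenever `e` is the index of a total machine. -/
theorem IsTypical.exists_run {x : ℕ → Fin 3} (hx : IsTypical x) {e : ℕ} (he : e ∈ TotSet)
    (M N : ℕ) : ∃ n, N ≤ n ∧ ∀ i < M + e + 1 + M,
      clean x (n + i) = if M ≤ i ∧ i < M + e + 1 then 1 else 0 := by
  classical
  have hinf : {s | Stage e s ∧ M ≤ s}.Infinite := by
    refine Set.infinite_of_not_bddAbove fun ⟨b, hb⟩ => ?_
    obtain ⟨s, hs, hst⟩ := exists_stage_ge he (max M (b + 1))
    have := hb ⟨hst, (le_max_left _ _).trans hs⟩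
    omega
  have hfirst : ∀ s, ∃ p, IsFirstBlock x p e s := by
    intro s
    have hex : ∃ p, IsBlock x p e s := by
      obtain ⟨p, -, hp⟩ := hx.exists_ge (blockSymbol e s) (2 * s + e + 3) 0
      exact ⟨p, hp⟩
    exact ⟨Nat.find hex, Nat.find_spec hex, fun q hq => Nat.find_min hex hq⟩
  choose p hp using hfirst
  have hinj : Set.InjOn p {s | Stage e s ∧ M ≤ s} := by
    intro s _ t _ hst
    exact ((hp s).1.unique (hst ▸ (hp t).1)).2
  obtain ⟨_, ⟨s, ⟨hst, hMs⟩, rfl⟩, hN⟩ := (hinf.image hinj).exists_gt N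
  have hbc := (hp s).isBlock_clean hst
  refine ⟨p s + 1 + s - M, by omega, fun i hi => ?_⟩
  rw [show p s + 1 + s - M + i = p s + (1 + s - M + i) by omega, hbc _ (by omega), blockSymbol,
    if_neg (by omega)]
  exact if_congr (by omega) rfl rfl

/-- A prefix of a point of the attractor which contains a one is a window of `0^∞ 1^(e+1) 0^∞`
for the index `e` of a total machine. -/
theorem exists_window_of_mem_totAttractor {y : ℕ → Fin 3} (hy : y ∈ totAttractor) {k : ℕ}
    (hk : y k = 1) (m : ℕ) : ∃ e ∈ TotSet, ∃ M c, c + m ≤ M + e + 1 + M ∧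
      ∀ i < m, y i = if M ≤ c + i ∧ c + i < M + e + 1 then 1 else 0 := by
  classical
  obtain ⟨h1, h2, h3⟩ := hy
  have hzero : ∀ i, y i ≠ 1 → y i = 0 := fun i hi => by
    have := h1 k i hk
    generalize y i = c at *
    revert c
    decide
  have hex : ∃ a, y a = 1 := ⟨k, hk⟩
  obtain ⟨a, ha, hmin⟩ : ∃ a, y a = 1 ∧ ∀ i < a, y i ≠ 1 :=
    ⟨Nat.find hex, Nat.find_spec hex, fun i hi => Nat.find_min hex hi⟩
  suffices ∃ e ∈ TotSet, ∃ M c, c + m ≤ M + e + 1 + M ∧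
      ∀ i < m, y i = 1 ↔ M ≤ c + i ∧ c + i < M + e + 1 by
    obtain ⟨e, he, M, c, hc, h⟩ := this
    refine ⟨e, he, M, c, hc, fun i hi => ?_⟩
    split_ifs with hin
    · exact (h i hi).2 hin
    · exact hzero i fun hi1 => hin ((h i hi).1 hi1)
  by_cases hend : ∃ b, a ≤ b ∧ y b ≠ 1
  · obtain ⟨b, hab, hb, hbmin⟩ : ∃ b, a ≤ b ∧ y b ≠ 1 ∧ ∀ i < b, a ≤ i → y i = 1 :=
      ⟨Nat.find hend, (Nat.find_spec hend).1, (Nat.find_spec hend).2, fun i hi hai => by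
        by_contra hne
        exact Nat.find_min hend hi ⟨hai, hne⟩⟩
    have hlt : a < b := lt_of_le_of_ne hab (by rintro rfl; exact hb ha)
    have hrun : ∀ i, y i = 1 ↔ a ≤ i ∧ i < b := by
      refine fun i => ⟨fun hi => ⟨not_lt.1 fun h => hmin i h hi, not_le.1 fun h => ?_⟩,
        fun hi => hbmin i hi.2 hi.1⟩
      rcases h.lt_or_eq with h | rfl
      · exact hb (h2 a b i hlt h ha hi)
      · exact hb hi
    rcases Nat.eq_zero_or_pos a with rfl | hpos
    · obtain ⟨e, he, hbe⟩ := exists_mem_totSet_ge b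
      exact ⟨e, he, m, m + e + 1 - b, by omega, fun i _ => by rw [hrun]; omega⟩
    · refine ⟨b - a - 1, h3 (a - 1) _ (hmin _ (by omega)) (fun i hi => ?_) ?_, m + a, m,
        by omega, fun i _ => by rw [hrun]; omega⟩
      · exact (hrun _).2 ⟨by omega, by omega⟩
      · rwa [show a - 1 + (b - a - 1) + 2 = b by omega]
  · push Not at hend
    obtain ⟨e, he, hme⟩ := exists_mem_totSet_ge m
    refine ⟨e, he, m + a, m, by omega, fun i hi =>
      ⟨fun h => ?_, fun h => hend i (by omega)⟩⟩
    have : a ≤ i := not_lt.1 fun hia => hmin i hia h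
    omega

theorem IsTypical.subset_omegaSet_cleanShift {x : ℕ → Fin 3} (hx : IsTypical x) :
    totAttractor ⊆ omegaSet cleanShift x := by
  intro y hy
  rw [mem_omegaSet_iff]
  intro m N
  suffices ∃ n, N + 1 ≤ n ∧ ∀ i < m, clean x (n + i) = y i by
    obtain ⟨n, hn, h⟩ := this
    exact ⟨n, by omega, fun i hi => by rw [cleanShift_iterate_apply x (by omega), h i hi]⟩
  by_cases h1 : ∃ k, y k = 1
  · obtain ⟨k, hk⟩ := h1
    obtain ⟨e, he, M, c, hc, hw⟩ := exists_window_of_mem_totAttractor hy hk m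
    obtain ⟨n, hn, h⟩ := hx.exists_run he M (N + 1)
    refine ⟨n + c, by omega, fun i hi => ?_⟩
    rw [add_assoc, h _ (by omega), hw i hi]
  · push Not at h1
    obtain ⟨n, hn, h⟩ := hx.exists_ge y m (N + 1)
    exact ⟨n, hn, fun i hi => by
      rw [clean_of_ne_one ((h i hi).trans_ne (h1 i)), h i hi]⟩

theorem IsTypical.omegaSet_cleanShift {x : ℕ → Fin 3} (hx : IsTypical x) :
    omegaSet cleanShift x = totAttractor := by
  obtain ⟨q, -, hq⟩ := hx.exists_ge (fun _ => 2) 1 0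
  exact (omegaSet_cleanShift_subset (hq 0 one_pos)).antisymm hx.subset_omegaSet_cleanShift

/-! ### The inner collection of the attractor -/

section InnerCollection

/-- The word `w` has a factor `1^(e+1)` starting at position `a + 1` and bounded on both sides by
letters other than `1`. -/
def HasRun (w : List (Fin 3)) (a e : ℕ) : Prop :=
  a + e + 2 < w.length ∧ w.getD a 0 ≠ 1 ∧ (∀ i < e + 1, w.getD (a + 1 + i) 0 = 1) ∧
    w.getD (a + e + 2) 0 ≠ 1

/-- The word `w` does not contain both a one and a separator, and its ones are contiguous. -/
def IsAdmissible (w : List (Fin 3)) : Prop :=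
  (∀ i < w.length, ∀ j < w.length, w.getD i 0 = 1 → w.getD j 0 ≠ 2) ∧
    ∀ k < w.length, ∀ j < k, ∀ i < j, w.getD i 0 = 1 → w.getD k 0 = 1 → w.getD j 0 = 1

theorem mem_cyl_iff {w : List (Fin 3)} {x : ℕ → Fin 3} :
    x ∈ cyl w ↔ ∀ i < w.length, x i = w.getD i 0 := by
  refine ⟨fun h i hi => ?_, fun h i => ?_⟩
  · simpa [List.getD, hi] using h ⟨i, hi⟩
  · simpa [List.getD] using h i i.2

theorem cyl_inter_totAttractor_nonempty_iff (w : List (Fin 3)) :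
    (cyl w ∩ totAttractor).Nonempty ↔ IsAdmissible w ∧ ∀ a e, HasRun w a e → e ∈ TotSet := by
  constructor
  · rintro ⟨y, hw, h1, h2, h3⟩
    rw [mem_cyl_iff] at hw
    refine ⟨⟨fun i hi j hj => ?_, fun k hk j hj i hi => ?_⟩, fun a e ⟨hlen, ha, he, hae⟩ => ?_⟩
    · rw [← hw i hi, ← hw j hj]
      exact h1 i j
    · rw [← hw i (by omega), ← hw j (by omega), ← hw k hk]
      exact h2 i j k hi hj
    · rw [← hw _ (by omega)] at ha hae
      exact h3 a e ha (fun i hi => by rw [hw _ (by omega), he i hi]) hae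
  · rintro ⟨⟨h1, h2⟩, h3⟩
    by_cases hw : w.length = 0
    · refine ⟨fun _ => 0, mem_cyl_iff.2 fun i hi => by omega, ?_, ?_, ?_⟩
      · simp
      · simp
      · intro a e _ he _
        exact absurd (he 0 (by omega)) (by simp)
    have hlast : ∀ i, min i (w.length - 1) < w.length := fun i => by omega
    obtain ⟨y, hy⟩ : ∃ y : ℕ → Fin 3, ∀ i, y i = w.getD (min i (w.length - 1)) 0 :=
      ⟨_, fun _ => rfl⟩
    have hin : ∀ i < w.length, y i = w.getD i 0 := fun i hi => by
      rw [hy, min_eq_left (by omega)]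
    have hout : ∀ i j, w.length - 1 ≤ i → i ≤ j → y i = y j := fun i j hi hj => by
      rw [hy, hy, min_eq_right hi, min_eq_right (hi.trans hj)]
    refine ⟨y, mem_cyl_iff.2 hin, fun i j => ?_, fun i j k hij hjk hi hk => ?_,
      fun a e ha he hae => ?_⟩
    · rw [hy, hy]
      exact h1 _ (hlast i) _ (hlast j)
    · rcases Nat.lt_or_ge j (w.length - 1) with hj | hj
      · rw [hin _ (by omega)] at hi ⊢
        rw [hy] at hk
        exact h2 _ (hlast k) _ (by omega) _ (by omega) hi hk
      · rwa [hout j k hj hjk.le]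
    · have hlen : a + e + 2 < w.length := by
        by_contra hcon
        exact hae ((hout (a + 1 + e) _ (by omega) (by omega)).symm.trans (he e (by omega)))
      refine h3 a e ⟨hlen, ?_, fun i hi => ?_, ?_⟩
      · rwa [← hin _ (by omega)]
      · rw [← hin _ (by omega), he i hi]
      · rwa [← hin _ (by omega)]

variable {α : Type*} [Primcodable α] {l : α → List (Fin 3)}

theorem primrecPred_letter_eq {n : α → ℕ} (hl : Primrec l) (hn : Primrec n) (c : Fin 3) :
    PrimrecPred fun a => (l a).getD (n a) 0 = c :=
  Primrec.eq.comp (primrec_letter hl hn) (Primrec.const c)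

theorem primrecPred_imp {p q : α → Prop} (hp : PrimrecPred p) (hq : PrimrecPred q) :
    PrimrecPred fun a => p a → q a :=
  (hp.not.or hq).of_eq fun _ => imp_iff_not_or.symm

theorem primrecPred_hasRun {n e : α → ℕ} (hl : Primrec l) (hn : Primrec n) (he : Primrec e) :
    PrimrecPred fun a => HasRun (l a) (n a) (e a) := by
  have hend : Primrec fun a => n a + e a + 2 :=
    Primrec.nat_add.comp (Primrec.nat_add.comp hn he) (Primrec.const 2)
  refine (Primrec.nat_lt.comp hend (Primrec.list_length.comp hl)).and
    ((primrecPred_letter_eq hl hn 1).not.and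
      (PrimrecPred.and ?_ (primrecPred_letter_eq hl hend 1).not))
  exact PrimrecPred.bounded_forall (Primrec.succ.comp he) (primrecPred_letter_eq
    (hl.comp Primrec.fst) (Primrec.nat_add.comp (Primrec.succ.comp (hn.comp Primrec.fst))
      Primrec.snd) 1)

theorem primrecPred_isAdmissible (hl : Primrec l) : PrimrecPred fun a => IsAdmissible (l a) := by
  have hlen : Primrec fun a => (l a).length := Primrec.list_length.comp hl
  refine PrimrecPred.and ?_ ?_
  · refine PrimrecPred.bounded_forall hlen (PrimrecPred.bounded_forall (hlen.comp Primrec.fst) ?_)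
    have hl' : Primrec fun q : (α × ℕ) × ℕ => l q.1.1 := hl.comp (Primrec.fst.comp Primrec.fst)
    exact primrecPred_imp (primrecPred_letter_eq hl' (Primrec.snd.comp Primrec.fst) 1)
      (primrecPred_letter_eq hl' Primrec.snd 2).not
  · refine PrimrecPred.bounded_forall hlen (PrimrecPred.bounded_forall Primrec.snd
      (PrimrecPred.bounded_forall Primrec.snd ?_))
    have hl' : Primrec fun q : ((α × ℕ) × ℕ) × ℕ => l q.1.1.1 :=
      hl.comp (Primrec.fst.comp (Primrec.fst.comp Primrec.fst))
    exact primrecPred_imp (primrecPred_letter_eq hl' Primrec.snd 1)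
      (primrecPred_imp (primrecPred_letter_eq hl'
        (Primrec.snd.comp (Primrec.fst.comp Primrec.fst)) 1)
        (primrecPred_letter_eq hl' (Primrec.snd.comp Primrec.fst) 1))

end InnerCollection

theorem piTwo_innerCollection : PiTwo {w : List (Fin 3) | (cyl w ∩ totAttractor).Nonempty} := by
  have hw : Primrec fun q : List (Fin 3) × ℕ × ℕ => q.1 := Primrec.fst
  have hc : Primrec fun q : List (Fin 3) × ℕ × ℕ => q.2.1.unpair :=
    Primrec.unpair.comp (Primrec.fst.comp Primrec.snd)
  have hd : Primrec fun q : List (Fin 3) × ℕ × ℕ => q.2.1.unpair.2.unpair :=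
    Primrec.unpair.comp (Primrec.snd.comp hc)
  obtain ⟨_, hdec⟩ := (primrecPred_isAdmissible hw).and (primrecPred_imp
    (primrecPred_hasRun hw (Primrec.fst.comp hc) (Primrec.fst.comp hd))
    (primrecPred_isSome_evaln (Primrec.snd.comp Primrec.snd) (Primrec.fst.comp hd)
      (Primrec.snd.comp hd)))
  refine ⟨_, hdec.to_comp, fun w => ?_⟩
  simp only [mem_ofPred_eq, cyl_inter_totAttractor_nonempty_iff, decide_eq_true_eq]
  constructor
  · rintro ⟨hadm, htot⟩ c
    by_cases hrun : HasRun w c.unpair.1 c.unpair.2.unpair.1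
    · obtain ⟨b, hb⟩ := (dom_iff_exists_evaln _ _).1 (htot _ _ hrun c.unpair.2.unpair.2)
      exact ⟨b, hadm, fun _ => hb⟩
    · exact ⟨0, hadm, fun h => absurd h hrun⟩
  · intro h
    refine ⟨(h 0).choose_spec.1, fun a e hrun n => (dom_iff_exists_evaln e n).2 ?_⟩
    obtain ⟨b, -, hb⟩ := h (Nat.pair a (Nat.pair e n))
    simp only [Nat.unpair_pair] at hb
    exact ⟨b, hb hrun⟩

/-- The word `0 1^(e+1) 0`. -/
def runWord (e : ℕ) : List (Fin 3) :=
  (List.range (e + 3)).map fun i => if i = 0 ∨ i = e + 2 then 0 else 1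

theorem runWord_getD {e i : ℕ} (hi : i < e + 3) :
    (runWord e).getD i 0 = if i = 0 ∨ i = e + 2 then 0 else 1 := by
  simp [runWord, List.getD, hi]

theorem primrec_runWord : Primrec runWord := by
  refine Primrec.list_map (Primrec.list_range.comp (Primrec.nat_add.comp Primrec.id
    (Primrec.const 3))) ?_
  exact Primrec.ite ((Primrec.eq.comp Primrec.snd (Primrec.const 0)).or
    (Primrec.eq.comp Primrec.snd (Primrec.nat_add.comp Primrec.fst (Primrec.const 2))))
    (Primrec.const 0) (Primrec.const 1)

theorem mem_totSet_iff_runWord (e : ℕ) :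
    e ∈ TotSet ↔ (cyl (runWord e) ∩ totAttractor).Nonempty := by
  have hlen : (runWord e).length = e + 3 := by simp [runWord]
  have hone : ∀ i < e + 3, (runWord e).getD i 0 = 1 ↔ ¬ (i = 0 ∨ i = e + 2) := by
    intro i hi
    rw [runWord_getD hi]
    split_ifs with h <;> simp [h]
  rw [cyl_inter_totAttractor_nonempty_iff]
  constructor
  · refine fun he => ⟨⟨fun i _ j hj _ => ?_, fun k hk j hj i hi _ _ => ?_⟩,
      fun a e' ⟨hl, ha, _, hae⟩ => ?_⟩
    · rw [runWord_getD (by omega)]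
      split_ifs <;> simp
    · exact (hone j (by omega)).2 (by omega)
    · rw [Ne, hone _ (by omega), not_not] at ha hae
      obtain rfl : e' = e := by omega
      exact he
  · rintro ⟨-, h⟩
    refine h 0 e ⟨by omega, ?_, fun i hi => (hone _ (by omega)).2 (by omega), ?_⟩ <;>
    · rw [Ne, hone _ (by omega), not_not]
      omega

/-! ### Typical points are residual and of full measure -/

theorem continuous_shiftMap : Continuous (shiftMap : (ℕ → Fin 3) → ℕ → Fin 3) :=
  continuous_pi fun i => continuous_apply (i + 1)

theorem isOpen_cyl (w : List (Fin 3)) : IsOpen (cyl w) := by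
  simp only [cyl, ofPred_forall]
  refine isOpen_iInter_of_finite fun i => ?_
  have hcont : Continuous fun x : ℕ → Fin 3 => x i := continuous_apply (i : ℕ)
  exact (isOpen_discrete {w.get i}).preimage hcont

theorem measurableSet_cyl (w : List (Fin 3)) : MeasurableSet (cyl w) := by
  simp only [cyl, ofPred_forall]
  exact MeasurableSet.iInter fun i =>
    (measurableSet_singleton (w.get i)).preimage (measurable_pi_apply (i : ℕ))

theorem residual_isTypical : {x : ℕ → Fin 3 | IsTypical x} ∈ residual (ℕ → Fin 3) := by
  simp only [IsTypical, frequently_atTop, ofPred_forall]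
  refine countable_iInter_mem.2 fun w => countable_iInter_mem.2 fun N =>
    residual_of_dense_open ?_ ?_
  · have : {x : ℕ → Fin 3 | ∃ n ≥ N, shiftMap^[n] x ∈ cyl w} =
        ⋃ n ≥ N, shiftMap^[n] ⁻¹' cyl w := by
      ext x
      simp
    rw [this]
    exact isOpen_biUnion fun n _ => (isOpen_cyl w).preimage (continuous_shiftMap.iterate n)
  · intro y
    rw [mem_closure_iff_nhds_basis (hasBasis_nhds_prefix y)]
    intro m _
    refine ⟨fun i => if i < max m N then y i else w.getD (i - max m N) 0,
      ⟨max m N, le_max_right _ _, mem_cyl_iff.2 fun i _ => ?_⟩, fun i hi => ?_⟩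
    · rw [shiftMap_iterate, if_neg (by omega), Nat.add_sub_cancel_left]
    · exact if_pos (lt_max_of_lt_left hi)

theorem ae_isTypical (lam : Measure (ℕ → Fin 3)) [IsProbabilityMeasure lam]
    (herg : Ergodic shiftMap lam) (hsupp : measSupport lam = Set.univ) :
    ∀ᵐ x ∂lam, IsTypical x := by
  refine ae_all_iff.2 fun w => ?_
  have hmeas : MeasurableSet {x | ∃ᶠ n in atTop, shiftMap^[n] x ∈ cyl w} := by
    have : {x | ∃ᶠ n in atTop, shiftMap^[n] x ∈ cyl w} =
        ⋂ N, ⋃ n ≥ N, shiftMap^[n] ⁻¹' cyl w := by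
      ext x
      simp [frequently_atTop]
    rw [this]
    exact .iInter fun N => .iUnion fun n => .iUnion fun _ =>
      (measurableSet_cyl w).preimage (herg.measurable.iterate n)
  have hinv : shiftMap ⁻¹' {x | ∃ᶠ n in atTop, shiftMap^[n] x ∈ cyl w} =
      {x | ∃ᶠ n in atTop, shiftMap^[n] x ∈ cyl w} := by
    ext x
    simp only [mem_preimage, mem_ofPred_eq, ← Function.iterate_succ_apply]
    rw [← frequently_map (m := Nat.succ) (P := fun n => shiftMap^[n] x ∈ cyl w)]
    exact iff_of_eq (congrArg _ (map_add_atTop_eq_nat 1))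
  rcases herg.ae_mem_or_ae_notMem hmeas hinv with h | h
  · exact h
  · have hrec := herg.toMeasurePreserving.conservative.ae_mem_imp_frequently_image_mem
      (measurableSet_cyl w).nullMeasurableSet
    have hnull : lam (cyl w) = 0 := measure_eq_zero_iff_ae_notMem.2 <| by
      filter_upwards [h, hrec] with x hx hrec hmem using hx (hrec hmem)
    have hmem : (fun i => w.getD i 0) ∈ measSupport lam := hsupp ▸ mem_univ _
    exact absurd hnull (hmem _ (isOpen_cyl w) (mem_cyl_iff.2 fun _ _ => rfl)).ne'

theorem IsTypical.mem_realm {x : ℕ → Fin 3} (hx : IsTypical x) :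
    x ∈ realm cleanShift totAttractor :=
  hx.omegaSet_cleanShift.subset

theorem IsTypical.notMem_realm {x : ℕ → Fin 3} (hx : IsTypical x) {A : Set (ℕ → Fin 3)}
    (hA : A ⊂ totAttractor) : x ∉ realm cleanShift A := fun h =>
  hA.2 (hx.omegaSet_cleanShift.superset.trans h)

theorem mapsTo_cleanShift_totAttractor : MapsTo cleanShift totAttractor totAttractor :=
  mapsTo_shiftMap_totAttractor.congr fun _ hy => (cleanShift_of_mem_totAttractor hy).symm

theorem isTopAttractor_totAttractor : IsTopAttractor cleanShift totAttractor :=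
  ⟨isClosed_totAttractor, mapsTo_cleanShift_totAttractor,
    mem_of_superset residual_isTypical fun _ hx => hx.mem_realm,
    fun _ _ hA => mem_of_superset residual_isTypical fun _ hx => hx.notMem_realm hA⟩

theorem isMetricAttractor_totAttractor (lam : Measure (ℕ → Fin 3)) [IsProbabilityMeasure lam]
    (herg : Ergodic shiftMap lam) (hsupp : measSupport lam = Set.univ) :
    IsMetricAttractor cleanShift lam totAttractor := by
  have htyp := ae_isTypical lam herg hsupp
  refine ⟨isClosed_totAttractor, mapsTo_cleanShift_totAttractor, ?_, fun A _ hA => ?_⟩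
  · have hfull : realm cleanShift totAttractor =ᵐ[lam] univ :=
      eventuallyEq_univ.2 (htyp.mono fun _ hx => hx.mem_realm)
    exact (measure_congr hfull).trans measure_univ
  · exact measure_eq_zero_iff_ae_notMem.2 (htyp.mono fun _ hx => hx.notMem_realm hA)

/-- A Π₂-complete attractor: a computable map of the Cantor space `{0,1,S}^ℕ` (alphabet
`Fin 3`) with a closed invariant set `A`, whose inner collection is Π₂ and Π₂-complete
(`Tot` many-one reduces to it), on which `T` acts as the shift, and which is both the
topological attractor and the metric attractor w.r.t. every shift-ergodic fully supported
reference measure. -/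
theorem stmt13 :
    ∃ (T : (ℕ → Fin 3) → (ℕ → Fin 3)) (A : Set (ℕ → Fin 3)),
      CantorComputable T ∧ IsClosed A ∧ Set.MapsTo T A A ∧
      -- (i)
      PiTwo {w : List (Fin 3) | (cyl w ∩ A).Nonempty} ∧
      ((fun e : ℕ => e ∈ TotSet) ≤₀ fun w : List (Fin 3) => (cyl w ∩ A).Nonempty) ∧
      -- (ii)
      (∀ x ∈ A, T x = shiftMap x) ∧
      -- (iii)
      IsTopAttractor T A ∧
      (∀ lam : Measure (ℕ → Fin 3), IsProbabilityMeasure lam → Ergodic shiftMap lam →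
        measSupport lam = Set.univ → IsMetricAttractor T lam A) := by
  exact ⟨cleanShift, totAttractor, cantorComputable_cleanShift, isClosed_totAttractor,
    mapsTo_cleanShift_totAttractor, piTwo_innerCollection,
    ⟨runWord, primrec_runWord.to_comp, mem_totSet_iff_runWord⟩,
    fun _ hy => cleanShift_of_mem_totAttractor hy, isTopAttractor_totAttractor,
    fun lam hlam herg hsupp => isMetricAttractor_totAttractor lam herg hsupp⟩
end

section
/- There exists a computable map T' on the Cantor space X over the alphabet ({0,1,S} × {a,b}) such that: (i) T' has a metric attractor A_m ⊆ X with respect to the uniform Bernoulli product measure on X whose inner collection {w : [w] ∩ A_m ≠ ∅} is a decidable (computable) set of words; and (ii) T' has a topological attractor A_t ⊆ X whose inner collection {w : [w] ∩ A_t ≠ ∅} is Π₂ and such that Tot many-one reduces to it. -/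
open Filter Topology MeasureTheory Set
open scoped ENNReal NNReal

namespace WildAttractor

/-- The alphabet `{0, 1, S} × {a, b}`. -/
abbrev Letter := Fin 3 × Fin 2

/-- The quiescent letter. -/
abbrev blank : Letter := (0, 0)

/-- The letter displayed by an excursion away from the quiescent point. -/
abbrev mark : Letter := (1, 0)

/-- The letter separating the processed part of a configuration from the raw input. -/
abbrev front : Letter := (2, 0)

/-- The machine of index `e` halts within `s` steps on all inputs below `k`. -/
def HaltsBelow (e k s : ℕ) : Prop :=
  ∀ i < k, (Nat.Partrec.Code.evaln s (Denumerable.ofNat Nat.Partrec.Code e) i).isSome = true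

/-- Between times `N / 2` and `N` the initial segment of inputs on which the machine of index `e`
is known to halt grows. -/
def Progresses (e N : ℕ) : Prop :=
  ∃ k < N + 1, HaltsBelow e k N ∧ ¬ HaltsBelow e k (N / 2)

/-- The block `[N, 2N)` of `x` requests a display of `e`, and the request is admissible. -/
def Launch (x : ℕ → Letter) (N e : ℕ) : Prop :=
  2 * e < N ∧ Progresses e N ∧ ∀ j < N, x (N + j) = if j = e then mark else blank

open Classical in
/-- The local rule: the letter at position `i` of the image of a sequence with prefix `l`. -/
noncomputable def localRule (i : ℕ) (l : List Letter) : Letter :=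
  if i + 1 < l.findIdx (fun a => decide (a = front)) then l.getD (i + 1) blank
  else if 2 * l.findIdx (fun a => decide (a = front)) + 1 < i then l.getD i blank
  else if i = 2 * l.findIdx (fun a => decide (a = front)) + 1 then front
  else if ∃ e < l.findIdx (fun a => decide (a = front)) + 1,
      Launch (fun j => l.getD j blank) (l.findIdx (fun a => decide (a = front)) + 1) e ∧
        (i + 1 = l.findIdx (fun a => decide (a = front)) ∨
          i = l.findIdx (fun a => decide (a = front)) + e) then mark
  else blank

/-- Sequences evolve by the shift to the left of the first `front`, which itself moves from `n` to
`2 * n + 1` while the block it jumps over is replaced by `blank`s or by an excursion. -/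
noncomputable def wildMap (x : ℕ → Letter) (i : ℕ) : Letter :=
  localRule i (List.ofFn fun j : Fin (2 * i + 3 + 1) => x j)

section Computability

variable {α : Type*} [Primcodable α]

theorem primrecPred_forall_lt {p : α → ℕ → Prop} {b : α → ℕ}
    (hp : PrimrecPred fun q : α × ℕ => p q.1 q.2) (hb : Primrec b) :
    PrimrecPred fun a => ∀ i < b a, p a i :=
  ((PrimrecRel.forall_mem_list (R := fun i a => p a i)
    (hp.comp (Primrec.pair Primrec.snd Primrec.fst))).comp
      (Primrec.list_range.comp hb) Primrec.id).of_eq fun a => by simp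

theorem primrecPred_exists_lt {p : α → ℕ → Prop} {b : α → ℕ}
    (hp : PrimrecPred fun q : α × ℕ => p q.1 q.2) (hb : Primrec b) :
    PrimrecPred fun a => ∃ i < b a, p a i :=
  ((PrimrecRel.exists_mem_list (R := fun i a => p a i)
    (hp.comp (Primrec.pair Primrec.snd Primrec.fst))).comp
      (Primrec.list_range.comp hb) Primrec.id).of_eq fun a => by simp

theorem primrec_evaln_isSome {s e i : α → ℕ} (hs : Primrec s) (he : Primrec e) (hi : Primrec i) :
    Primrec fun a => (Nat.Partrec.Code.evaln (s a)
      (Denumerable.ofNat Nat.Partrec.Code (e a)) (i a)).isSome :=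
  Primrec.option_isSome.comp (Nat.Partrec.Code.primrec_evaln.comp
    (Primrec.pair (Primrec.pair hs ((Primrec.ofNat _).comp he)) hi))

theorem primrecPred_haltsBelow {e k s : α → ℕ} (he : Primrec e) (hk : Primrec k)
    (hs : Primrec s) : PrimrecPred fun a => HaltsBelow (e a) (k a) (s a) :=
  primrecPred_forall_lt
    (Primrec.eq.comp (primrec_evaln_isSome (hs.comp Primrec.fst) (he.comp Primrec.fst) Primrec.snd)
      (Primrec.const true)) hk

theorem primrecPred_progresses {e N : α → ℕ} (he : Primrec e) (hN : Primrec N) :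
    PrimrecPred fun a => Progresses (e a) (N a) :=
  primrecPred_exists_lt
    ((primrecPred_haltsBelow (he.comp Primrec.fst) Primrec.snd (hN.comp Primrec.fst)).and
      (primrecPred_haltsBelow (he.comp Primrec.fst) Primrec.snd
        (Primrec.nat_div.comp (hN.comp Primrec.fst) (Primrec.const 2))).not)
    (Primrec.succ.comp hN)

theorem primrecPred_launch {l : α → List Letter} {N e : α → ℕ} (hl : Primrec l)
    (hN : Primrec N) (he : Primrec e) :
    PrimrecPred fun a => Launch (fun j => (l a).getD j blank) (N a) (e a) := by
  refine PrimrecPred.and ?_ (PrimrecPred.and (primrecPred_progresses he hN) ?_)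
  · exact Primrec.nat_lt.comp (Primrec.nat_mul.comp (Primrec.const 2) he) hN
  · refine primrecPred_forall_lt (Primrec.eq.comp ?_ ?_) hN
    · exact (Primrec.list_getD blank).comp (hl.comp Primrec.fst)
        (Primrec.nat_add.comp (hN.comp Primrec.fst) Primrec.snd)
    · exact Primrec.ite (Primrec.eq.comp Primrec.snd (he.comp Primrec.fst))
        (Primrec.const mark) (Primrec.const blank)

theorem primrec_localRule : Primrec₂ localRule := by
  classical
  have hn : Primrec fun p : ℕ × List Letter => p.2.findIdx (fun a => decide (a = front)) :=
    Primrec.list_findIdx Primrec.snd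
      (Primrec.eq.decide.comp Primrec.snd (Primrec.const front))
  have hi : Primrec fun p : ℕ × List Letter => p.1 := Primrec.fst
  have h2n := Primrec.succ.comp (Primrec.nat_mul.comp (Primrec.const 2) hn)
  have hi1 := Primrec.succ.comp hi
  refine Primrec.ite (Primrec.nat_lt.comp hi1 hn)
    ((Primrec.list_getD blank).comp Primrec.snd hi1) ?_
  refine Primrec.ite (Primrec.nat_lt.comp h2n hi)
    ((Primrec.list_getD blank).comp Primrec.snd hi) ?_
  refine Primrec.ite (Primrec.eq.comp hi h2n) (Primrec.const front) ?_
  refine Primrec.ite ?_ (Primrec.const mark) (Primrec.const blank)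
  refine primrecPred_exists_lt (PrimrecPred.and ?_ (PrimrecPred.or ?_ ?_)) (Primrec.succ.comp hn)
  · exact primrecPred_launch (Primrec.snd.comp Primrec.fst)
      (Primrec.succ.comp (hn.comp Primrec.fst)) Primrec.snd
  · exact Primrec.eq.comp (hi1.comp Primrec.fst) (hn.comp Primrec.fst)
  · exact Primrec.eq.comp (hi.comp Primrec.fst)
      (Primrec.nat_add.comp (hn.comp Primrec.fst) Primrec.snd)

theorem cantorComputable_wildMap : CantorComputable wildMap := by
  refine ⟨fun n => 2 * n + 3, localRule, ?_, primrec_localRule.to_comp, fun x n => rfl⟩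
  exact (Primrec.nat_add.comp (Primrec.nat_mul.comp (Primrec.const 2) Primrec.id)
    (Primrec.const 3)).to_comp

end Computability

section Halting

theorem eval_dom_iff {c : Nat.Partrec.Code} {n : ℕ} :
    (c.eval n).Dom ↔ ∃ s, (Nat.Partrec.Code.evaln s c n).isSome = true := by
  simp only [Part.dom_iff_mem, Option.isSome_iff_exists, Nat.Partrec.Code.evaln_complete,
    Option.mem_def]
  exact exists_comm

theorem isSome_evaln_mono {c : Nat.Partrec.Code} {n s s' : ℕ} (h : s ≤ s')
    (hs : (Nat.Partrec.Code.evaln s c n).isSome = true) :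
    (Nat.Partrec.Code.evaln s' c n).isSome = true := by
  obtain ⟨v, hv⟩ := Option.isSome_iff_exists.1 hs
  exact Option.isSome_iff_exists.2 ⟨v, Nat.Partrec.Code.evaln_mono h hv⟩

theorem HaltsBelow.mono {e k k' s s' : ℕ} (h : HaltsBelow e k s) (hk : k' ≤ k) (hs : s ≤ s') :
    HaltsBelow e k' s' :=
  fun i hi => isSome_evaln_mono hs (h i (hi.trans_le hk))

theorem HaltsBelow.le {e k s : ℕ} (h : HaltsBelow e k s) : k ≤ s := by
  by_contra! hlt
  obtain ⟨v, hv⟩ := Option.isSome_iff_exists.1 (h s hlt)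
  exact lt_irrefl _ (Nat.Partrec.Code.evaln_bound hv)

theorem mem_totSet_iff {e : ℕ} : e ∈ TotSet ↔ ∀ k, ∃ s, HaltsBelow e k s := by
  refine ⟨fun h k => ?_, fun h n => ?_⟩
  · induction k with
    | zero => exact ⟨0, fun i hi => absurd hi (Nat.not_lt_zero i)⟩
    | succ k ih =>
      obtain ⟨s, hs⟩ := ih
      obtain ⟨s', hs'⟩ := eval_dom_iff.1 (h k)
      refine ⟨max s s', fun i hi => ?_⟩
      rcases Nat.lt_succ_iff_lt_or_eq.1 hi with hi | rfl
      · exact isSome_evaln_mono (le_max_left _ _) (hs i hi)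
      · exact isSome_evaln_mono (le_max_right _ _) hs'
  · obtain ⟨s, hs⟩ := h (n + 1)
    exact eval_dom_iff.2 ⟨s, hs n n.lt_succ_self⟩

theorem exists_progresses_of_mem_totSet {e N₀ : ℕ} (he : e ∈ TotSet) (hN₀ : 0 < N₀) (M : ℕ) :
    ∃ t, M ≤ t ∧ Progresses e (2 ^ t * N₀) := by
  classical
  set k := 2 ^ M * N₀ + 1 with hk
  have hex : ∃ t, HaltsBelow e k (2 ^ t * N₀) := by
    obtain ⟨s, hs⟩ := mem_totSet_iff.1 he k
    exact ⟨s, hs.mono le_rfl (Nat.lt_two_pow_self.le.trans (Nat.le_mul_of_pos_right _ hN₀))⟩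
  have hM : M < Nat.find hex := by
    by_contra! hle
    have := ((Nat.find_spec hex).mono le_rfl
      (Nat.mul_le_mul_right N₀ (Nat.pow_le_pow_right two_pos hle))).le
    omega
  obtain ⟨t, ht⟩ : ∃ t, Nat.find hex = t + 1 := Nat.exists_eq_add_of_lt hM |>.imp' (M + ·) (by omega)
  have hspec := Nat.find_spec hex
  rw [ht] at hspec
  refine ⟨t + 1, by omega, k, Nat.lt_succ_of_le hspec.le, hspec, ?_⟩
  have h2 : 2 ^ (t + 1) * N₀ / 2 = 2 ^ t * N₀ := by
    rw [pow_succ, mul_right_comm, Nat.mul_div_cancel _ two_pos]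
  rw [h2]
  exact Nat.find_min hex (by omega)

theorem mem_totSet_of_frequently_progresses {e : ℕ} (h : ∀ B, ∃ N, B ≤ N ∧ Progresses e N) :
    e ∈ TotSet := by
  refine mem_totSet_iff.2 fun k => ?_
  induction k with
  | zero => exact ⟨0, fun i hi => absurd hi (Nat.not_lt_zero i)⟩
  | succ k ih =>
    obtain ⟨s, hs⟩ := ih
    obtain ⟨N, hN, k', -, h1, h2⟩ := h (2 * s)
    refine ⟨N, h1.mono ?_ le_rfl⟩
    by_contra! hlt
    exact h2 (hs.mono (by omega) (by omega))

theorem exists_le_mem_totSet (n : ℕ) : ∃ e, n ≤ e ∧ e ∈ TotSet := by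
  have hinj : Function.Injective fun m => Encodable.encode (Nat.Partrec.Code.const m) :=
    fun a b hab => Nat.Partrec.Code.const_inj (Encodable.encode_injective hab)
  obtain ⟨_, ⟨m, rfl⟩, hm⟩ := (Set.infinite_range_of_injective hinj).exists_gt n
  refine ⟨_, hm.le, fun k => ?_⟩
  simp

end Halting

/-- The topological attractor: sequences of `blank`s with at most two `mark`s, where two `mark`s
may only be separated by `e` letters for an index `e` of a total machine. -/
def topAttractor : Set (ℕ → Letter) :=
  {z | (∀ i, z i = blank ∨ z i = mark) ∧ ∀ i e, z i = mark → z (i + e + 1) = mark →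
    e ∈ TotSet ∧ ∀ k, i + e + 1 < k → z k ≠ mark}

section Language

theorem mem_cyl_iff {w : List Letter} {x : ℕ → Letter} :
    x ∈ cyl w ↔ ∀ i < w.length, x i = w.getD i blank := by
  constructor
  · intro h i hi
    simpa [hi] using h ⟨i, hi⟩
  · intro h i
    simpa using h i i.2

theorem cyl_inter_topAttractor_nonempty_iff {w : List Letter} :
    (cyl w ∩ topAttractor).Nonempty ↔ (fun j => w.getD j blank) ∈ topAttractor := by
  constructor
  · rintro ⟨z, hzw, hz, hz'⟩
    rw [mem_cyl_iff] at hzw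
    have key : ∀ i, w.getD i blank = mark → z i = mark := by
      intro i hi
      by_cases hlt : i < w.length
      · rw [hzw i hlt, hi]
      · rw [List.getD_eq_default _ _ (not_lt.1 hlt)] at hi
        exact absurd hi (by decide)
    refine ⟨fun i => ?_, fun i e hi he => ?_⟩
    · by_cases hlt : i < w.length
      · simpa only [hzw i hlt] using hz i
      · exact Or.inl (List.getD_eq_default _ _ (not_lt.1 hlt))
    · exact ⟨(hz' i e (key _ hi) (key _ he)).1,
        fun k hk hm => (hz' i e (key _ hi) (key _ he)).2 k hk (key _ hm)⟩
  · exact fun h => ⟨_, mem_cyl_iff.2 fun _ _ => rfl, h⟩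

theorem mem_topAttractor_iff {z : ℕ → Letter} : z ∈ topAttractor ↔ ∀ i e k n, ∃ b,
    (z i = blank ∨ z i = mark) ∧ (¬ z i = mark ∨ ¬ z (i + e + 1) = mark ∨
      (Nat.Partrec.Code.evaln b (Denumerable.ofNat Nat.Partrec.Code e) n).isSome = true ∧
        (¬ i + e + 1 < k ∨ ¬ z k = mark)) := by
  constructor
  · rintro ⟨h1, h2⟩ i e k n
    by_cases hi : z i = mark
    · by_cases he : z (i + e + 1) = mark
      · obtain ⟨b, hb⟩ := eval_dom_iff.1 ((h2 i e hi he).1 n)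
        exact ⟨b, h1 i, Or.inr (Or.inr ⟨hb, (em (i + e + 1 < k)).elim
          (fun hk => Or.inr ((h2 i e hi he).2 k hk)) Or.inl⟩)⟩
      · exact ⟨0, h1 i, Or.inr (Or.inl he)⟩
    · exact ⟨0, h1 i, Or.inl hi⟩
  · intro h
    refine ⟨fun i => (h i 0 0 0).choose_spec.1, fun i e hi he => ⟨fun n => ?_, fun k hk => ?_⟩⟩
    · obtain ⟨b, -, hb⟩ := h i e 0 n
      refine eval_dom_iff.2 ⟨b, ?_⟩
      tauto
    · obtain ⟨b, -, hb⟩ := h i e k 0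
      tauto

theorem piTwo_topAttractor : PiTwo {w : List Letter | (cyl w ∩ topAttractor).Nonempty} := by
  classical
  let C : List Letter × ℕ × ℕ → Prop := fun p =>
    let i := p.2.1.unpair.1.unpair.1
    let e := p.2.1.unpair.1.unpair.2
    let k := p.2.1.unpair.2.unpair.1
    let n := p.2.1.unpair.2.unpair.2
    (p.1.getD i blank = blank ∨ p.1.getD i blank = mark) ∧
      (¬ p.1.getD i blank = mark ∨ ¬ p.1.getD (i + e + 1) blank = mark ∨
      (Nat.Partrec.Code.evaln p.2.2 (Denumerable.ofNat Nat.Partrec.Code e) n).isSome = true ∧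
        (¬ i + e + 1 < k ∨ ¬ p.1.getD k blank = mark))
  have hC : PrimrecPred C := by
    have ha : Primrec fun p : List Letter × ℕ × ℕ => p.2.1.unpair :=
      Primrec.unpair.comp (Primrec.fst.comp Primrec.snd)
    have hl := Primrec.unpair.comp (Primrec.fst.comp ha)
    have hr := Primrec.unpair.comp (Primrec.snd.comp ha)
    have hi := Primrec.fst.comp hl
    have he := Primrec.snd.comp hl
    have hk := Primrec.fst.comp hr
    have hn := Primrec.snd.comp hr
    have hj := Primrec.succ.comp (Primrec.nat_add.comp hi he)
    have hget : ∀ {f : List Letter × ℕ × ℕ → ℕ}, Primrec f → ∀ a : Letter,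
        PrimrecPred fun p : List Letter × ℕ × ℕ => p.1.getD (f p) blank = a := fun hf a =>
      Primrec.eq.comp ((Primrec.list_getD blank).comp Primrec.fst hf) (Primrec.const a)
    have hev := Primrec.eq.comp (primrec_evaln_isSome (Primrec.snd.comp Primrec.snd) he hn)
      (Primrec.const true)
    exact ((hget hi blank).or (hget hi mark)).and ((hget hi mark).not.or ((hget hj mark).not.or
      (hev.and ((Primrec.nat_lt.comp hj hk).not.or (hget hk mark).not))))
  refine ⟨fun p => decide (C p), hC.decide.to_comp, fun w => ?_⟩
  rw [Set.mem_ofPred_eq, cyl_inter_topAttractor_nonempty_iff, mem_topAttractor_iff]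
  constructor
  · intro h a
    obtain ⟨b, hb⟩ := h a.unpair.1.unpair.1 a.unpair.1.unpair.2 a.unpair.2.unpair.1
      a.unpair.2.unpair.2
    exact ⟨b, decide_eq_true hb⟩
  · intro h i e k n
    obtain ⟨b, hb⟩ := h (Nat.pair (Nat.pair i e) (Nat.pair k n))
    refine ⟨b, ?_⟩
    simpa [C] using hb

/-- The word `S 1ᵉ S`. -/
def displayWord (e : ℕ) : List Letter :=
  (List.range (e + 2)).map fun i => if i = 0 ∨ i = e + 1 then mark else blank

theorem displayWord_getD (e i : ℕ) :
    (displayWord e).getD i blank = if i = 0 ∨ i = e + 1 then mark else blank := by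
  by_cases hi : i < e + 2
  · simp [displayWord, List.getD, hi]
  · rw [List.getD_eq_default _ _ (by simpa [displayWord] using hi), if_neg (by omega)]

theorem totSet_manyOneReducible :
    (fun e : ℕ => e ∈ TotSet) ≤₀ fun w : List Letter => (cyl w ∩ topAttractor).Nonempty := by
  refine ⟨displayWord, Primrec.to_comp ?_, fun e => ?_⟩
  · refine Primrec.list_map
      (Primrec.list_range.comp (Primrec.nat_add.comp Primrec.id (Primrec.const 2))) ?_
    exact Primrec.ite ((Primrec.eq.comp Primrec.snd (Primrec.const 0)).or
      (Primrec.eq.comp Primrec.snd (Primrec.succ.comp Primrec.fst)))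
      (Primrec.const mark) (Primrec.const blank)
  · have hmark : ∀ i, (displayWord e).getD i blank = mark ↔ i = 0 ∨ i = e + 1 := by
      intro i
      rw [displayWord_getD]
      split_ifs with h <;> simp [h]
    change e ∈ TotSet ↔ (cyl (displayWord e) ∩ topAttractor).Nonempty
    rw [cyl_inter_topAttractor_nonempty_iff]
    simp only [topAttractor, Set.mem_ofPred_eq, ne_eq, hmark]
    constructor
    · intro h
      refine ⟨fun i => ?_, fun i e' h1 h2 => ?_⟩
      · by_cases hi : i = 0 ∨ i = e + 1
        · exact Or.inr hi
        · exact Or.inl (by rw [displayWord_getD, if_neg hi])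
      · obtain rfl : e' = e := by omega
        exact ⟨h, fun k hk => by omega⟩
    · intro h
      exact (h.2 0 e (by simp) (by simp)).1

theorem computablePred_cyl_inter_singleton :
    ComputablePred fun w : List Letter => (cyl w ∩ {fun _ => blank}).Nonempty := by
  have : PrimrecPred fun w : List Letter => ∀ a ∈ w, a = blank :=
    (Primrec.eq.comp Primrec.id (Primrec.const blank)).forall_mem_list
  refine (this.of_eq fun w => ?_).computablePred
  simp only [Set.inter_singleton_nonempty, cyl, Set.mem_ofPred_eq, List.get_eq_getElem]
  constructor
  · exact fun h i => (h _ (List.getElem_mem _)).symm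
  · intro h a ha
    obtain ⟨i, hi, rfl⟩ := List.getElem_of_mem ha
    exact (h ⟨i, hi⟩).symm

end Language

/-- The first `front` of `x` is at position `n`. -/
def FrontAt (x : ℕ → Letter) (n : ℕ) : Prop := x n = front ∧ ∀ i < n, x i ≠ front

section Step

theorem Launch.congr {x y : ℕ → Letter} {N e : ℕ} (h : Launch x N e)
    (hxy : ∀ j < N, x (N + j) = y (N + j)) : Launch y N e :=
  ⟨h.1, h.2.1, fun j hj => hxy j hj ▸ h.2.2 j hj⟩

theorem launch_congr {x y : ℕ → Letter} {N e : ℕ} (hxy : ∀ j < N, x (N + j) = y (N + j)) :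
    Launch x N e ↔ Launch y N e :=
  ⟨fun h => h.congr hxy, fun h => h.congr fun j hj => (hxy j hj).symm⟩

theorem Launch.lt {x : ℕ → Letter} {N e : ℕ} (h : Launch x N e) : e < N := by
  have := h.1
  omega

theorem Launch.unique {x : ℕ → Letter} {N e e' : ℕ} (h : Launch x N e) (h' : Launch x N e') :
    e = e' := by
  have h1 := h.2.2 e h.lt
  rw [h'.2.2 e h.lt, if_pos rfl] at h1
  by_contra hne
  rw [if_neg hne] at h1
  exact absurd h1 (by decide)

theorem ofFn_getD {x : ℕ → Letter} {m j : ℕ} (hj : j < m) :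
    (List.ofFn fun i : Fin m => x i).getD j blank = x j := by
  simp [List.getD, hj]

theorem findIdx_ofFn {x : ℕ → Letter} {n m : ℕ} (h : FrontAt x n) (hn : n < m) :
    (List.ofFn fun i : Fin m => x i).findIdx (fun a => decide (a = front)) = n := by
  rw [List.findIdx_eq (by simpa using hn)]
  simpa [h.1] using h.2

theorem wildMap_of_forall_ne {x : ℕ → Letter} {i : ℕ} (h : ∀ j ≤ i + 1, x j ≠ front) :
    wildMap x i = x (i + 1) := by
  unfold wildMap localRule
  rw [if_pos, ofFn_getD (by omega)]
  refine List.lt_findIdx_of_not (by simp; omega) fun j hj => ?_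
  simpa only [List.getElem_ofFn, decide_eq_true_eq] using h j hj

variable {x : ℕ → Letter} {n : ℕ}

theorem FrontAt.wildMap_of_lt (h : FrontAt x n) {i : ℕ} (hi : i + 1 < n) :
    wildMap x i = x (i + 1) :=
  wildMap_of_forall_ne fun j hj => h.2 j (by omega)

theorem FrontAt.wildMap_of_gt (h : FrontAt x n) {i : ℕ} (hi : 2 * n + 1 < i) :
    wildMap x i = x i := by
  unfold wildMap localRule
  rw [findIdx_ofFn h (by omega), if_neg (by omega), if_pos hi, ofFn_getD (by omega)]

theorem FrontAt.wildMap_front (h : FrontAt x n) : wildMap x (2 * n + 1) = front := by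
  unfold wildMap localRule
  rw [findIdx_ofFn h (by omega), if_neg (by omega), if_neg (by omega), if_pos rfl]

open Classical in
theorem FrontAt.wildMap_block (h : FrontAt x n) {i : ℕ} (hi : n ≤ i + 1) (hi' : i ≤ 2 * n) :
    wildMap x i =
      if ∃ e < n + 1, Launch x (n + 1) e ∧ (i + 1 = n ∨ i = n + e) then mark else blank := by
  unfold wildMap localRule
  rw [findIdx_ofFn h (by omega), if_neg (by omega), if_neg (by omega), if_neg (by omega)]
  have : ∀ e, Launch (fun j => (List.ofFn fun j : Fin (2 * i + 3 + 1) => x j).getD j blank)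
      (n + 1) e ↔ Launch x (n + 1) e := fun e => launch_congr fun j hj => ofFn_getD (by omega)
  simp only [this]

theorem FrontAt.wildMap (h : FrontAt x n) : FrontAt (wildMap x) (2 * n + 1) := by
  classical
  refine ⟨h.wildMap_front, fun i hi => ?_⟩
  by_cases hlt : i + 1 < n
  · rw [h.wildMap_of_lt hlt]
    exact h.2 _ hlt
  · rw [h.wildMap_block (by omega) (by omega)]
    split_ifs <;> decide

end Step

section Orbit

variable {x : ℕ → Letter} {n : ℕ}

theorem FrontAt.iterate (h : FrontAt x n) (t : ℕ) : ∃ m, m + 1 = 2 ^ t * (n + 1) ∧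
    FrontAt (WildAttractor.wildMap^[t] x) m ∧
    ∀ i, m < i → WildAttractor.wildMap^[t] x i = x i := by
  induction t with
  | zero => exact ⟨n, by simp, h, fun _ _ => rfl⟩
  | succ t ih =>
    obtain ⟨m, hm, hf, heq⟩ := ih
    refine ⟨2 * m + 1, by rw [pow_succ, mul_right_comm, ← hm]; ring, ?_, fun i hi => ?_⟩
    · rw [Function.iterate_succ_apply']
      exact hf.wildMap
    · rw [Function.iterate_succ_apply', hf.wildMap_of_gt hi, heq i (by omega)]

/-- Left of the `front`, a configuration lists the first letters of its future orbit. -/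
theorem FrontAt.apply_eq_iterate (h : FrontAt x n) {i : ℕ} (hi : i < n) :
    x i = WildAttractor.wildMap^[i] x 0 := by
  induction i generalizing x n with
  | zero => rfl
  | succ i ih =>
    rw [← h.wildMap_of_lt hi, ih h.wildMap (by omega), Function.iterate_succ_apply]

/-- The time at which the block created at step `s` reaches the origin, if the first `front` is
initially at `n`. -/
def start (n s : ℕ) : ℕ := s + 2 ^ s * (n + 1) - 1

theorem start_succ (n s : ℕ) : start n (s + 1) = start n s + 2 ^ s * (n + 1) + 1 := by
  have : 0 < 2 ^ s * (n + 1) := by positivity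
  have h2 : 2 ^ (s + 1) * (n + 1) = 2 * (2 ^ s * (n + 1)) := by ring
  unfold start
  omega

theorem start_strictMono (n : ℕ) : StrictMono (start n) :=
  strictMono_nat_of_lt_succ fun s => by rw [start_succ]; omega

theorem le_start (n s : ℕ) : s ≤ start n s := (start_strictMono n).le_apply

open Classical in
theorem FrontAt.orbit_block (h : FrontAt x n) {s m : ℕ} (hs : 1 ≤ s)
    (hm : m ≤ 2 ^ s * (n + 1)) : WildAttractor.wildMap^[start n s + m] x 0 =
      if ∃ e, Launch x (2 ^ s * (n + 1)) e ∧ (m = 0 ∨ m = e + 1) then mark else blank := by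
  obtain ⟨p, hp, hf, heq⟩ := h.iterate s
  have hp2 : 2 ≤ p + 1 := by
    rw [hp]
    calc 2 = 2 ^ 1 * 1 := rfl
      _ ≤ 2 ^ s * (n + 1) := Nat.mul_le_mul (Nat.pow_le_pow_right two_pos hs) (by omega)
  have hst : start n s + m = (p + m - 1) + (s + 1) := by
    unfold start
    omega
  rw [hst, Function.iterate_add_apply, Function.iterate_succ_apply',
    ← hf.wildMap.apply_eq_iterate (by omega), hf.wildMap_block (by omega) (by omega), ← hp]
  congr 1
  refine propext (exists_congr fun e => ?_)
  have hl : Launch (WildAttractor.wildMap^[s] x) (p + 1) e ↔ Launch x (p + 1) e :=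
    launch_congr fun j hj => heq _ (by omega)
  rw [hl]
  constructor
  · rintro ⟨-, h1, h2⟩
    exact ⟨h1, by omega⟩
  · rintro ⟨h1, h2⟩
    exact ⟨h1.lt, h1, by omega⟩

theorem exists_start_add (n : ℕ) {M k : ℕ} (hk : start n M ≤ k) :
    ∃ s m, M ≤ s ∧ m ≤ 2 ^ s * (n + 1) ∧ k = start n s + m := by
  induction k, hk using Nat.le_induction with
  | base => exact ⟨M, 0, le_rfl, Nat.zero_le _, rfl⟩
  | succ k _ ih =>
    obtain ⟨s, m, hs, hm, rfl⟩ := ih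
    rcases hm.lt_or_eq with hlt | rfl
    · exact ⟨s, m + 1, hs, hlt, rfl⟩
    · exact ⟨s + 1, 0, by omega, Nat.zero_le _, by rw [start_succ]⟩

theorem FrontAt.orbit_blank_or_mark (h : FrontAt x n) {k : ℕ} (hk : start n 1 ≤ k) :
    WildAttractor.wildMap^[k] x 0 = blank ∨ WildAttractor.wildMap^[k] x 0 = mark := by
  classical
  obtain ⟨s, m, hs, hm, rfl⟩ := exists_start_add n hk
  rw [h.orbit_block hs hm]
  split_ifs <;> simp

theorem FrontAt.exists_launch_of_mark (h : FrontAt x n) {M k : ℕ} (hM : 1 ≤ M)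
    (hk : start n M ≤ k) (hmark : WildAttractor.wildMap^[k] x 0 = mark) :
    ∃ s m e, M ≤ s ∧ m ≤ 2 ^ s * (n + 1) ∧ k = start n s + m ∧
      Launch x (2 ^ s * (n + 1)) e ∧ (m = 0 ∨ m = e + 1) := by
  classical
  obtain ⟨s, m, hs, hm, rfl⟩ := exists_start_add n hk
  rw [h.orbit_block (hM.trans hs) hm] at hmark
  split_ifs at hmark with hex
  · obtain ⟨e, he⟩ := hex
    exact ⟨s, m, e, hs, hm, rfl, he⟩
  · exact absurd hmark (by decide)

theorem FrontAt.launch_of_pair (h : FrontAt x n) {M k e : ℕ} (hM : 1 ≤ M) (hk : start n M ≤ k)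
    (he : 2 * (e + 1) ≤ 2 ^ M) (h1 : WildAttractor.wildMap^[k] x 0 = mark)
    (h2 : WildAttractor.wildMap^[k + e + 1] x 0 = mark) :
    ∃ s, M ≤ s ∧ k = start n s ∧ Launch x (2 ^ s * (n + 1)) e := by
  obtain ⟨s, m, e₁, hs, hm, hkm, hl, hme⟩ := h.exists_launch_of_mark hM hk h1
  obtain ⟨s', m', e₂, hs', hm', hkm', hl', hme'⟩ :=
    h.exists_launch_of_mark hM (k := k + e + 1) (by omega) h2
  rcases lt_trichotomy s s' with hlt | rfl | hlt
  · exfalso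
    have h3 := (start_strictMono n).monotone (show s + 1 ≤ s' from hlt)
    rw [start_succ] at h3
    have h4 : 2 ^ M ≤ 2 ^ s * (n + 1) :=
      (Nat.pow_le_pow_right two_pos hs).trans (Nat.le_mul_of_pos_right _ n.succ_pos)
    have h5 := hl.1
    omega
  · obtain rfl := hl.unique hl'
    obtain rfl : e = e₁ := by omega
    exact ⟨s, hs, by omega, hl⟩
  · exfalso
    have h3 := (start_strictMono n).monotone (show s' + 1 ≤ s from hlt)
    rw [start_succ] at h3
    omega

theorem FrontAt.not_three_marks (h : FrontAt x n) {M a b c : ℕ} (hM : 1 ≤ M)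
    (ha : start n M ≤ a) (hab : a < b) (hbc : b < c) (hac : 2 * (c - a) ≤ 2 ^ M)
    (h1 : WildAttractor.wildMap^[a] x 0 = mark) (h2 : WildAttractor.wildMap^[b] x 0 = mark)
    (h3 : WildAttractor.wildMap^[c] x 0 = mark) : False := by
  obtain ⟨s, -, hs, hl⟩ := h.launch_of_pair (e := b - a - 1) hM ha (by omega) h1
    (by rwa [show a + (b - a - 1) + 1 = b by omega])
  obtain ⟨s', -, hs', hl'⟩ := h.launch_of_pair (e := c - a - 1) hM ha (by omega) h1
    (by rwa [show a + (c - a - 1) + 1 = c by omega])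
  obtain rfl := (start_strictMono n).injective (hs.symm.trans hs')
  have := hl.unique hl'
  omega

end Orbit

section OmegaLimit

theorem prefix_mem_nhds (z : ℕ → Letter) (L : ℕ) : {x | ∀ i < L, x i = z i} ∈ 𝓝 z := by
  have : {x : ℕ → Letter | ∀ i < L, x i = z i} = ⋂ i ∈ Set.Iio L, {x | x i = z i} := by
    ext x
    simp
  rw [this]
  exact (Filter.biInter_mem (Set.finite_Iio L)).2 fun i _ =>
    (continuous_apply i).continuousAt (mem_nhds_discrete.2 (Set.mem_singleton (z i)))

theorem exists_prefix_subset {z : ℕ → Letter} {U : Set (ℕ → Letter)} (hU : U ∈ 𝓝 z) :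
    ∃ L, {x | ∀ i < L, x i = z i} ⊆ U := by
  rw [nhds_pi, Filter.mem_pi] at hU
  obtain ⟨I, hI, t, ht, hsub⟩ := hU
  obtain ⟨L, hL⟩ := hI.bddAbove
  refine ⟨L + 1, fun x hx => hsub fun i hi => ?_⟩
  rw [hx i (Nat.lt_succ_of_le (hL hi))]
  exact mem_of_mem_nhds (ht i)

theorem mem_omegaSet_iff {T : (ℕ → Letter) → ℕ → Letter} {x z : ℕ → Letter} :
    z ∈ omegaSet T x ↔ ∀ L M, ∃ t, M ≤ t ∧ ∀ i < L, T^[t] x i = z i := by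
  simp only [omegaSet, Set.mem_ofPred_eq, mapClusterPt_iff_frequently]
  constructor
  · intro h L M
    exact (Filter.frequently_atTop.1 (h _ (prefix_mem_nhds z L))) M
  · intro h U hU
    obtain ⟨L, hL⟩ := exists_prefix_subset hU
    exact Filter.frequently_atTop.2 fun M => (h L M).imp fun t ht => ⟨ht.1, hL ht.2⟩

theorem omegaSet_nonempty (T : (ℕ → Letter) → ℕ → Letter) (x : ℕ → Letter) :
    (omegaSet T x).Nonempty :=
  exists_clusterPt_of_compactSpace (Filter.map (fun n => T^[n] x) Filter.atTop)

variable {x : ℕ → Letter} {n : ℕ}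

theorem FrontAt.mem_omegaSet_iff (h : FrontAt x n) {z : ℕ → Letter} :
    z ∈ omegaSet WildAttractor.wildMap x ↔
      ∀ L M, ∃ t, M ≤ t ∧ ∀ i < L, WildAttractor.wildMap^[t + i] x 0 = z i := by
  have key : ∀ L t, L ≤ t → ∀ i < L,
      WildAttractor.wildMap^[t] x i = WildAttractor.wildMap^[t + i] x 0 := by
    intro L t ht i hi
    obtain ⟨m, hm, hf, -⟩ := h.iterate t
    have : t < 2 ^ t * (n + 1) :=
      Nat.lt_two_pow_self.trans_le (Nat.le_mul_of_pos_right _ n.succ_pos)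
    rw [hf.apply_eq_iterate (by omega), add_comm, Function.iterate_add_apply]
  rw [WildAttractor.mem_omegaSet_iff]
  refine forall_congr' fun L => ⟨fun H M => ?_, fun H M => ?_⟩
  · obtain ⟨t, ht, hz⟩ := H (max L M)
    exact ⟨t, by omega, fun i hi => by rw [← key L t (by omega) i hi, hz i hi]⟩
  · obtain ⟨t, ht, hz⟩ := H (max L M)
    exact ⟨t, by omega, fun i hi => by rw [key L t (by omega) i hi, hz i hi]⟩

theorem FrontAt.omegaSet_subset (h : FrontAt x n) :
    omegaSet WildAttractor.wildMap x ⊆ topAttractor := by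
  intro z hz
  rw [h.mem_omegaSet_iff] at hz
  refine ⟨fun i => ?_, fun i e hi he => ⟨?_, fun k hk hzk => ?_⟩⟩
  · obtain ⟨t, ht, hzt⟩ := hz (i + 1) (start n 1)
    rw [← hzt i (by omega)]
    exact h.orbit_blank_or_mark (by omega)
  · refine mem_totSet_of_frequently_progresses fun B => ?_
    obtain ⟨t, ht, hzt⟩ := hz (i + e + 2) (start n (B + 2 * e + 3))
    have hpow : B + 2 * e + 3 < 2 ^ (B + 2 * e + 3) := Nat.lt_two_pow_self
    obtain ⟨s, hs, -, hl⟩ := h.launch_of_pair (M := B + 2 * e + 3) (k := t + i) (e := e)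
      (by omega) (by omega) (by omega) (by rw [hzt i (by omega), hi])
      (by rw [add_assoc, add_assoc, ← add_assoc i, hzt _ (by omega), he])
    refine ⟨_, ?_, hl.2.1⟩
    have : s < 2 ^ s * (n + 1) :=
      Nat.lt_two_pow_self.trans_le (Nat.le_mul_of_pos_right _ n.succ_pos)
    omega
  · obtain ⟨t, ht, hzt⟩ := hz (k + 1) (start n (2 * k + 1))
    have hpow : 2 * k + 1 < 2 ^ (2 * k + 1) := Nat.lt_two_pow_self
    exact h.not_three_marks (M := 2 * k + 1) (a := t + i) (b := t + (i + e + 1)) (c := t + k)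
      (by omega) (by omega) (by omega) (by omega) (by omega)
      (by rw [hzt _ (by omega), hi]) (by rw [hzt _ (by omega), he])
      (by rw [hzt _ (by omega), hzk])

theorem exists_display_prefix {z : ℕ → Letter} (hz : z ∈ topAttractor) (L : ℕ) :
    ∃ i₀, ∃ e ∈ TotSet, ∀ i < L, z i = mark ↔ i = i₀ ∨ i = i₀ + e + 1 := by
  classical
  obtain ⟨e₀, hLe, he₀⟩ := exists_le_mem_totSet L
  by_cases h1 : ∃ i, z i = mark
  · have hi := Nat.find_spec h1
    have hmin : ∀ j, z j = mark → Nat.find h1 ≤ j := fun j hj => Nat.find_min' h1 hj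
    by_cases h2 : ∃ e, z (Nat.find h1 + e + 1) = mark
    · obtain ⟨e, he⟩ := h2
      obtain ⟨htot, hlast⟩ := hz.2 _ e hi he
      refine ⟨Nat.find h1, e, htot, fun i _ => ⟨fun him => ?_, ?_⟩⟩
      · by_contra! hne
        have hlt : Nat.find h1 < i := lt_of_le_of_ne (hmin i him) hne.1.symm
        rcases lt_or_gt_of_ne hne.2 with h | h
        · have := (hz.2 _ (i - Nat.find h1 - 1) hi
            (by rwa [show Nat.find h1 + (i - Nat.find h1 - 1) + 1 = i by omega])).2
            (Nat.find h1 + e + 1) (by omega)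
          exact this he
        · exact hlast i h him
      · rintro (rfl | rfl)
        exacts [hi, he]
    · push Not at h2
      refine ⟨Nat.find h1, e₀, he₀, fun i hiL => ⟨fun him => ?_, ?_⟩⟩
      · by_contra! hne
        have hlt : Nat.find h1 < i := lt_of_le_of_ne (hmin i him) hne.1.symm
        exact h2 (i - Nat.find h1 - 1)
          (by rwa [show Nat.find h1 + (i - Nat.find h1 - 1) + 1 = i by omega])
      · rintro (rfl | rfl)
        · exact hi
        · omega
  · push Not at h1
    exact ⟨L, e₀, he₀, fun i hiL => ⟨fun h => absurd h (h1 i), by omega⟩⟩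

theorem FrontAt.topAttractor_subset_omegaSet (h : FrontAt x n)
    (hx : ∀ e ∈ TotSet, ∀ M, ∃ s, M ≤ s ∧ Launch x (2 ^ s * (n + 1)) e) :
    topAttractor ⊆ omegaSet WildAttractor.wildMap x := by
  classical
  intro z hz
  rw [h.mem_omegaSet_iff]
  intro L M
  obtain ⟨i₀, e, he, hze⟩ := exists_display_prefix hz L
  set M' := 2 * (L + i₀ + e + 1) + 1 with hM'
  have hpow : M' < 2 ^ M' := Nat.lt_two_pow_self
  obtain ⟨s, hs, hl⟩ := hx e he (i₀ + M + start n M' + 1)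
  have hse := le_start n s
  have hs1 : start n s = start n s - i₀ + i₀ := by omega
  set t := start n s - i₀ with ht
  have hm1 : WildAttractor.wildMap^[t + i₀] x 0 = mark := by
    rw [← hs1, ← add_zero (start n s), h.orbit_block (by omega) (Nat.zero_le _)]
    exact if_pos ⟨e, hl, Or.inl rfl⟩
  have hm2 : WildAttractor.wildMap^[t + (i₀ + e + 1)] x 0 = mark := by
    rw [show t + (i₀ + e + 1) = start n s + (e + 1) by omega,
      h.orbit_block (by omega) hl.lt]
    exact if_pos ⟨e, hl, Or.inr rfl⟩
  have hstart : start n 1 ≤ start n M' := (start_strictMono n).monotone (by omega)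
  refine ⟨t, by omega, fun i hi => ?_⟩
  have hiff : WildAttractor.wildMap^[t + i] x 0 = mark ↔ z i = mark := by
    rw [hze i hi]
    refine ⟨fun hm => ?_, ?_⟩
    · by_contra! hne
      rcases lt_or_gt_of_ne hne.1 with h1 | h1
      · exact h.not_three_marks (M := M') (by omega) (by omega)
          (show t + i < t + i₀ by omega) (show _ < t + (i₀ + e + 1) by omega) (by omega) hm hm1 hm2
      · rcases lt_or_gt_of_ne hne.2 with h2 | h2
        · exact h.not_three_marks (M := M') (by omega) (by omega)
            (show t + i₀ < t + i by omega) (show _ < t + (i₀ + e + 1) by omega) (by omega) hm1 hm hm2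
        · exact h.not_three_marks (M := M') (by omega) (by omega)
            (show t + i₀ < t + (i₀ + e + 1) by omega) (show _ < t + i by omega) (by omega) hm1 hm2 hm
    · rintro (rfl | rfl)
      exacts [hm1, hm2]
  rcases hz.1 i with hb | hm
  · rw [hb]
    refine (h.orbit_blank_or_mark (by omega)).resolve_right fun hm => ?_
    rw [hiff.1 hm] at hb
    exact absurd hb (by decide)
  · rw [hiff.2 hm, hm]

theorem FrontAt.omegaSet_subset_singleton (h : FrontAt x n) {M : ℕ}
    (hx : ∀ s, M ≤ s → ∀ e, ¬ Launch x (2 ^ s * (n + 1)) e) :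
    omegaSet WildAttractor.wildMap x ⊆ {fun _ => blank} := by
  intro z hz
  rw [h.mem_omegaSet_iff] at hz
  refine funext fun i => ?_
  obtain ⟨t, ht, hzt⟩ := hz (i + 1) (start n (M + 1))
  rw [← hzt i (by omega)]
  refine (h.orbit_blank_or_mark ?_).resolve_right fun hm => ?_
  · exact ((start_strictMono n).monotone (show 1 ≤ M + 1 by omega)).trans (by omega)
  · obtain ⟨s, m, e, hs, -, -, hl, -⟩ :=
      h.exists_launch_of_mark (M := M + 1) (by omega) (by omega) hm
    exact hx s (by omega) e hl

end OmegaLimit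

section Generic

theorem FrontAt.unique {x : ℕ → Letter} {n n' : ℕ} (h : FrontAt x n) (h' : FrontAt x n') :
    n = n' := by
  rcases lt_trichotomy n n' with hlt | heq | hlt
  · exact absurd h.1 (h'.2 n hlt)
  · exact heq
  · exact absurd h'.1 (h.2 n' hlt)

theorem exists_frontAt {x : ℕ → Letter} (h : ∃ i, x i = front) : ∃ n, FrontAt x n := by
  classical
  exact ⟨Nat.find h, Nat.find_spec h, fun i hi => Nat.find_min h hi⟩

/-- The points launching an excursion displaying `e` at some step after `M`. -/
def launchSet (e M : ℕ) : Set (ℕ → Letter) :=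
  {x | ∃ n s, FrontAt x n ∧ M ≤ s ∧ Launch x (2 ^ s * (n + 1)) e}

theorem isOpen_launchSet (e M : ℕ) : IsOpen (launchSet e M) := by
  refine isOpen_iff_mem_nhds.2 fun x hx => ?_
  obtain ⟨n, s, hf, hs, hl⟩ := hx
  filter_upwards [prefix_mem_nhds x (n + 1 + 2 * (2 ^ s * (n + 1)))] with y hy
  refine ⟨n, s, ⟨?_, fun i hi => ?_⟩, hs, hl.congr fun j hj => (hy _ (by omega)).symm⟩
  · rw [hy n (by omega), hf.1]
  · rw [hy i (by omega)]
    exact hf.2 i hi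

theorem dense_launchSet {e : ℕ} (he : e ∈ TotSet) (M : ℕ) : Dense (launchSet e M) := by
  intro z
  refine mem_closure_iff_nhds.2 fun V hV => ?_
  obtain ⟨L, hL⟩ := exists_prefix_subset hV
  let y : ℕ → (ℕ → Letter) := fun k i =>
    if i < L then z i else if i = L then front else if i = k then mark else blank
  have hy : ∀ k k' i, i ≤ L → y k i = y k' i := by
    intro k k' i hi
    rcases hi.lt_or_eq with hi | rfl <;> simp [y, *]
  have hyL : ∀ k, y k L = front := fun k => by simp [y]
  obtain ⟨n, hn⟩ := exists_frontAt ⟨L, hyL 0⟩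
  have hnL : n ≤ L := by
    by_contra! hlt
    exact hn.2 L hlt (hyL 0)
  obtain ⟨s, hs, hprog⟩ := exists_progresses_of_mem_totSet he n.succ_pos (M + 2 * e + L)
  have hlt : s < 2 ^ s * (n + 1) :=
    Nat.lt_two_pow_self.trans_le (Nat.le_mul_of_pos_right _ n.succ_pos)
  refine ⟨y (2 ^ s * (n + 1) + e), hL fun i hi => by simp [y, hi], n, s, ⟨?_, fun i hi => ?_⟩,
    by omega, by omega, hprog, fun j _ => ?_⟩
  · rw [hy _ 0 n hnL, hn.1]
  · rw [hy _ 0 i (by omega)]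
    exact hn.2 i hi
  · simp only [y]
    rw [if_neg (by omega), if_neg (by omega)]
    simp

theorem eventually_residual_mem_launchSet :
    ∀ᶠ x in residual (ℕ → Letter), ∀ e ∈ TotSet, ∀ M, x ∈ launchSet e M :=
  (eventually_countable_ball (Set.to_countable TotSet)).2 fun e he =>
    eventually_countable_forall.2 fun M =>
      residual_of_dense_open (isOpen_launchSet e M) (dense_launchSet he M)

theorem eventually_residual_omegaSet :
    ∀ᶠ x in residual (ℕ → Letter), omegaSet wildMap x = topAttractor := by
  filter_upwards [eventually_residual_mem_launchSet] with x hx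
  obtain ⟨e, -, he⟩ := exists_le_mem_totSet 0
  obtain ⟨n, -, hn, -⟩ := hx e he 0
  refine hn.omegaSet_subset.antisymm (hn.topAttractor_subset_omegaSet fun e he M => ?_)
  obtain ⟨n', s, hn', hs, hl⟩ := hx e he M
  obtain rfl := hn.unique hn'
  exact ⟨s, hs, hl⟩

theorem isClosed_topAttractor : IsClosed topAttractor := by
  rw [← isOpen_compl_iff, isOpen_iff_mem_nhds]
  intro z hz
  simp only [topAttractor, Set.mem_compl_iff, Set.mem_ofPred_eq, not_and_or, not_forall] at hz
  rcases hz with ⟨i, hi⟩ | ⟨i, e, h1, h2, h3⟩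
  · filter_upwards [prefix_mem_nhds z (i + 1)] with y hy hyA
    exact hi (hy i (by omega) ▸ hyA.1 i)
  · rcases h3 with h3 | ⟨k, hk, h3⟩
    · filter_upwards [prefix_mem_nhds z (i + e + 2)] with y hy hyA
      exact h3 (hyA.2 i e (by rw [hy _ (by omega), h1]) (by rw [hy _ (by omega), h2])).1
    · filter_upwards [prefix_mem_nhds z (k + 1)] with y hy hyA
      refine h3 (hy k (by omega) ▸ (hyA.2 i e ?_ ?_).2 k hk)
      · rw [hy _ (by omega), h1]
      · rw [hy _ (by omega), h2]

theorem mapsTo_topAttractor : Set.MapsTo wildMap topAttractor topAttractor := by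
  intro z hz
  have hshift : wildMap z = fun i => z (i + 1) := funext fun i =>
    wildMap_of_forall_ne fun j _ hj => by
      rcases hz.1 j with h | h <;> rw [hj] at h <;> exact absurd h (by decide)
  rw [hshift]
  refine ⟨fun i => hz.1 (i + 1), fun i e hi he => ?_⟩
  have := hz.2 (i + 1) e hi (by rwa [show i + 1 + e + 1 = i + e + 1 + 1 by omega])
  exact ⟨this.1, fun k hk => this.2 (k + 1) (by omega)⟩

theorem isTopAttractor_topAttractor : IsTopAttractor wildMap topAttractor := by
  refine ⟨isClosed_topAttractor, mapsTo_topAttractor, ?_, fun A' _ hA' => ?_⟩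
  · filter_upwards [eventually_residual_omegaSet] with x hx
    exact hx.subset
  · change _ ∈ residual _
    filter_upwards [eventually_residual_omegaSet] with x hx hxA'
    exact hA'.not_subset (hx ▸ hxA')

end Generic

section Bernoulli

variable {lam : Measure (ℕ → Letter)}

theorem measure_prefix_le
    (hlam : ∀ w : List Letter, lam (cyl w) = ((Fintype.card Letter : ℝ≥0∞))⁻¹ ^ w.length)
    (m : ℕ) (S : ℕ → Finset Letter) :
    lam {x | ∀ i < m, x i ∈ S i} ≤
      (∏ i ∈ Finset.range m, ((S i).card : ℝ≥0∞)) * (6 : ℝ≥0∞)⁻¹ ^ m := by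
  have hsub : {x : ℕ → Letter | ∀ i < m, x i ∈ S i} ⊆
      ⋃ f ∈ Fintype.piFinset (fun i : Fin m => S i), cyl (List.ofFn f) := by
    intro x hx
    simp only [Set.mem_iUnion]
    refine ⟨fun i => x i, Fintype.mem_piFinset.2 fun i => hx i i.2, fun i => ?_⟩
    simp
  refine (measure_mono hsub).trans ((measure_biUnion_finset_le _ _).trans (le_of_eq ?_))
  simp only [hlam, List.length_ofFn, Finset.sum_const, Fintype.card_piFinset, nsmul_eq_mul]
  rw [Finset.prod_range fun i => ((S i).card : ℝ≥0∞)]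
  simp

theorem ae_exists_frontAt
    (hlam : ∀ w : List Letter, lam (cyl w) = ((Fintype.card Letter : ℝ≥0∞))⁻¹ ^ w.length) :
    ∀ᵐ x ∂lam, ∃ n, FrontAt x n := by
  have hle : ∀ m : ℕ, lam {x | ¬ ∃ n, FrontAt x n} ≤ (5 * 6⁻¹ : ℝ≥0∞) ^ m := by
    intro m
    have hcard : (Finset.univ.erase front : Finset Letter).card = 5 := by decide
    refine (measure_mono fun x hx i _ => ?_).trans
      ((measure_prefix_le hlam m fun _ => Finset.univ.erase front).trans (le_of_eq ?_))
    · exact Finset.mem_erase.2 ⟨fun h => hx (exists_frontAt ⟨i, h⟩), Finset.mem_univ _⟩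
    · simp [hcard, mul_pow]
  have hlt : (5 * 6⁻¹ : ℝ≥0∞) < 1 := by
    rw [← div_eq_mul_inv]
    exact ENNReal.div_lt_of_lt_mul (by norm_num)
  exact le_antisymm (ge_of_tendsto' (ENNReal.tendsto_pow_atTop_nhds_zero_of_lt_one hlt) hle)
    zero_le

theorem measure_launch_le
    (hlam : ∀ w : List Letter, lam (cyl w) = ((Fintype.card Letter : ℝ≥0∞))⁻¹ ^ w.length)
    {N s : ℕ} (hs : 2 * s ≤ N) : lam {x | ∃ e, Launch x N e} ≤ (6 : ℝ≥0∞)⁻¹ ^ s := by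
  refine (measure_mono ?_).trans ((measure_prefix_le hlam (2 * N - s + s) fun i =>
    if i < 2 * N - s then Finset.univ else {blank}).trans (le_of_eq ?_))
  · rintro x ⟨e, hl⟩ i hi
    split_ifs with hlt
    · exact Finset.mem_univ _
    · have := hl.2.2 (i - N) (by omega)
      have he := hl.1
      rw [if_neg (by omega), show N + (i - N) = i by omega] at this
      exact Finset.mem_singleton.2 this
  · have h1 : ∏ i ∈ Finset.range (2 * N - s),
        (((if i < 2 * N - s then Finset.univ else {blank} : Finset Letter).card : ℕ) : ℝ≥0∞) =
        6 ^ (2 * N - s) := by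
      rw [Finset.prod_congr rfl fun i hi => by rw [if_pos (Finset.mem_range.1 hi)]]
      simp
    have h2 : ∏ i ∈ Finset.range s, (((if 2 * N - s + i < 2 * N - s then Finset.univ
        else {blank} : Finset Letter).card : ℕ) : ℝ≥0∞) = 1 := by
      simp
    rw [Finset.prod_range_add, h1, h2, mul_one, pow_add, ← mul_assoc, ← mul_pow,
      ENNReal.mul_inv_cancel (by norm_num) (by norm_num), one_pow, one_mul]

theorem ae_eventually_not_launch
    (hlam : ∀ w : List Letter, lam (cyl w) = ((Fintype.card Letter : ℝ≥0∞))⁻¹ ^ w.length) :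
    ∀ᵐ x ∂lam, ∀ n, ∀ᶠ s in Filter.atTop, ¬ ∃ e, Launch x (2 ^ s * (n + 1)) e := by
  refine ae_all_iff.2 fun n => ?_
  refine ae_eventually_notMem (s := fun s => {x | ∃ e, Launch x (2 ^ s * (n + 1)) e}) ?_
  have hle : ∀ s, lam {x | ∃ e, Launch x (2 ^ s * (n + 1)) e} ≤ (6 : ℝ≥0∞)⁻¹ ^ s := by
    intro s
    refine measure_launch_le hlam (le_trans ?_ (Nat.le_mul_of_pos_right _ n.succ_pos))
    cases s with
    | zero => simp
    | succ s =>
      rw [pow_succ']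
      exact Nat.mul_le_mul_left 2 Nat.lt_two_pow_self
  refine ne_top_of_le_ne_top ?_ (ENNReal.tsum_le_tsum hle)
  rw [ENNReal.tsum_geometric, ENNReal.inv_ne_top]
  exact (tsub_pos_of_lt (ENNReal.inv_lt_one.2 (by norm_num))).ne'

theorem isMetricAttractor_blank [IsProbabilityMeasure lam]
    (hlam : ∀ w : List Letter, lam (cyl w) = ((Fintype.card Letter : ℝ≥0∞))⁻¹ ^ w.length) :
    IsMetricAttractor wildMap lam {fun _ => blank} := by
  refine ⟨isClosed_singleton, ?_, ?_, fun A' _ hA' => ?_⟩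
  · rintro _ rfl
    exact funext fun i => wildMap_of_forall_ne fun _ _ => by decide
  · have hae : ∀ᵐ x ∂lam, x ∈ realm wildMap {fun _ => blank} := by
      filter_upwards [ae_exists_frontAt hlam, ae_eventually_not_launch hlam] with x ⟨n, hn⟩ hx
      obtain ⟨M, hM⟩ := Filter.eventually_atTop.1 (hx n)
      exact hn.omegaSet_subset_singleton fun s hs e hl => hM s hs ⟨e, hl⟩
    refine le_antisymm prob_le_one ?_
    rw [← measure_univ (μ := lam)]
    exact measure_mono_ae (hae.mono fun x hx _ => hx)
  · rw [Set.ssubset_singleton_iff.1 hA']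
    convert measure_empty (μ := lam)
    refine Set.eq_empty_of_forall_notMem fun x hx => ?_
    exact (omegaSet_nonempty wildMap x).ne_empty (Set.subset_empty_iff.1 hx)

end Bernoulli

end WildAttractor

/-- Wild attractors I: a computable map of the Cantor space over the alphabet
`{0,1,S} × {a,b}` (i.e. `Fin 3 × Fin 2`) whose metric attractor (w.r.t. the uniform Bernoulli
product measure) has decidable inner collection, while its topological attractor has a
Π₂-complete inner collection. -/
theorem stmt14 :
    ∃ (T' : (ℕ → Fin 3 × Fin 2) → (ℕ → Fin 3 × Fin 2))
      (Am At : Set (ℕ → Fin 3 × Fin 2)),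
      CantorComputable T' ∧
      -- (i) metric attractor with decidable inner collection
      (∀ lam : Measure (ℕ → Fin 3 × Fin 2), IsProbabilityMeasure lam →
        (∀ w : List (Fin 3 × Fin 2),
          lam (cyl w) = ((Fintype.card (Fin 3 × Fin 2) : ℝ≥0∞))⁻¹ ^ w.length) →
        IsMetricAttractor T' lam Am) ∧
      ComputablePred (fun w : List (Fin 3 × Fin 2) => (cyl w ∩ Am).Nonempty) ∧
      -- (ii) topological attractor with Π₂-complete inner collection
      IsTopAttractor T' At ∧
      PiTwo {w : List (Fin 3 × Fin 2) | (cyl w ∩ At).Nonempty} ∧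
      ((fun e : ℕ => e ∈ TotSet) ≤₀
        fun w : List (Fin 3 × Fin 2) => (cyl w ∩ At).Nonempty) := by
  exact ⟨WildAttractor.wildMap, {fun _ => WildAttractor.blank}, WildAttractor.topAttractor,
    WildAttractor.cantorComputable_wildMap,
    fun _ _ hlam => WildAttractor.isMetricAttractor_blank hlam,
    WildAttractor.computablePred_cyl_inter_singleton,
    WildAttractor.isTopAttractor_topAttractor, WildAttractor.piTwo_topAttractor,
    WildAttractor.totSet_manyOneReducible⟩
end
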